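/- arXiv:1111.5001 — 10 statements merged into one kernel-verified Lean document; each statement's English description precedes it below -/
import Mathlib

section
/- Assume ρ ∉ {4π·(n + ∑_{i∈I}(1 + α i)) : n ∈ ℕ, I a finite subset of Fin m with 0 ∉ I} (the singular values computed disregarding the index 0). Then there exists α* ∈ (−1,0) such that for every a ∈ (−1, α*), the modified family α' defined by α' 0 := a and α' i := α i for i ≠ 0 is p₀-stable, i.e. for every k ∈ ℕ and finite I ⊆ Fin m with k + card(I) > 0 and 4π·(k + ∑_{i∈I}(1 + α' i)) < ρ one also has 4π·(k + ∑_{i∈I∪{0}}(1 + α' i)) < ρ. -/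
open Finset

/-- The weight `w(k,I) = k + ∑_{i ∈ I} (1 + α i)`. -/
noncomputable def wgt {m : ℕ} (α : Fin m → ℝ) (k : ℕ) (I : Finset (Fin m)) : ℝ :=
  (k : ℝ) + ∑ i ∈ I, (1 + α i)

/-- The configuration `(ρ, α)` is `p_j`-stable. -/
def pStable {m : ℕ} (α : Fin m → ℝ) (ρ : ℝ) (j : Fin m) : Prop :=
  ∀ (k : ℕ) (I : Finset (Fin m)), 0 < k + I.card →
    4 * Real.pi * wgt α k I < ρ → 4 * Real.pi * wgt α k (insert j I) < ρ

/-- if `ρ` avoids the singular values computed disregarding the index `0`,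
then for `α 0` close enough to `-1` the modified configuration is `p₀`-stable. -/
theorem pStable_of_close_to_neg_one {m : ℕ} (hm : 0 < m) (α : Fin m → ℝ)
    (hα : ∀ i, α i ∈ Set.Ioo (-1 : ℝ) 0) (ρ : ℝ) (hρ : 0 < ρ)
    (hsing : ρ ∉ {x : ℝ | ∃ (n : ℕ) (I : Finset (Fin m)),
      (⟨0, hm⟩ : Fin m) ∉ I ∧ x = 4 * Real.pi * wgt α n I}) :
    ∃ αstar ∈ Set.Ioo (-1 : ℝ) 0, ∀ a ∈ Set.Ioo (-1 : ℝ) αstar,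
      pStable (Function.update α ⟨0, hm⟩ a) ρ ⟨0, hm⟩ := by
  have hπ : (1 : ℝ) < 4 * Real.pi := by linarith [Real.pi_gt_three]
  have hev : ∀ᶠ a in nhdsWithin (-1 : ℝ) (Set.Ioi (-1)),
      ∀ p ∈ (Finset.range (⌈ρ⌉₊ + 1)) ×ˢ (Finset.univ : Finset (Finset (Fin m))),
        4 * Real.pi * wgt α p.1 p.2 < ρ →
          4 * Real.pi * (wgt α p.1 p.2 + (1 + a)) < ρ := by
    rw [Filter.eventually_all_finset]
    intro p _
    by_cases h : 4 * Real.pi * wgt α p.1 p.2 < ρ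
    · have hc : Continuous fun a : ℝ => 4 * Real.pi * (wgt α p.1 p.2 + (1 + a)) := by
        fun_prop
      have h1 := hc.continuousAt.eventually_lt (continuousAt_const (x := (-1 : ℝ)) (y := ρ))
        (by simpa using h)
      filter_upwards [nhdsWithin_le_nhds h1] with a ha _ using ha
    · exact Filter.Eventually.of_forall fun a h' => absurd h' h
  obtain ⟨u, hu, hsub⟩ := mem_nhdsGT_iff_exists_Ioo_subset.1 hev
  have hu' : (-1 : ℝ) < u := hu
  refine ⟨min u (-1 / 2), ⟨lt_min hu' (by norm_num),
    lt_of_le_of_lt (min_le_right _ _) (by norm_num)⟩, ?_⟩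
  intro a ha k I _ hlt
  by_cases h0 : (⟨0, hm⟩ : Fin m) ∈ I
  · rwa [Finset.insert_eq_of_mem h0]
  · have hw : wgt (Function.update α ⟨0, hm⟩ a) k I = wgt α k I := by
      unfold wgt
      congr 1
      refine Finset.sum_congr rfl fun i hi => ?_
      have hne : i ≠ ⟨0, hm⟩ := fun h => h0 (h ▸ hi)
      rw [Function.update_of_ne hne]
    have hw' : wgt (Function.update α ⟨0, hm⟩ a) k (insert ⟨0, hm⟩ I)
        = wgt α k I + (1 + a) := by
      rw [← hw]
      unfold wgt
      rw [Finset.sum_insert h0, Function.update_self]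
      ring
    rw [hw] at hlt
    rw [hw']
    have hk : (k : ℝ) ≤ wgt α k I := by
      unfold wgt
      have : 0 ≤ ∑ i ∈ I, (1 + α i) :=
        Finset.sum_nonneg fun i _ => by linarith [(hα i).1]
      linarith
    have hk0 : (0 : ℝ) ≤ k := Nat.cast_nonneg k
    have hkρ : (k : ℝ) < ρ := by nlinarith
    have hkN : k < ⌈ρ⌉₊ + 1 := by
      have := Nat.lt_ceil.2 hkρ
      omega
    exact hsub ⟨ha.1, lt_of_lt_of_le ha.2 (min_le_left _ _)⟩ (k, I)
      (by simpa using hkN) hlt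
end

section
/- Let X be an infinite metric space, p : Fin m → X injective, α : Fin m → ℝ with −1 < α i < 0, ρ > 0, and fix an index j ∈ Fin m. Then the following two conditions are equivalent: (1) for every σ ∈ Σ_{ρ,α} and every t ∈ [0,1], the measure (1−t)·σ + t·δ_{p j} belongs to Σ_{ρ,α}; (2) for every k ∈ ℕ and every finite I ⊆ Fin m with k + card(I) > 0 and 4π·(k + ∑_{i∈I}(1 + α i)) < ρ, one has 4π·(k + ∑_{i∈I∪{j}}(1 + α i)) < ρ. -/
open Finset MeasureTheory Classical

/-- The weighted cardinality `χ(q)`: equals `1 + α i` if `q = p i`, and `1` otherwise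
(`p` being injective, at most one summand is nonzero). -/
noncomputable def wchi {X : Type*} {m : ℕ} (p : Fin m → X) (α : Fin m → ℝ) (q : X) : ℝ :=
  1 + ∑ i : Fin m, if p i = q then α i else 0

/-- The space of formal barycenters `Σ_{ρ,α}`. -/
noncomputable def formalBarycenters {X : Type*} [MeasurableSpace X] {m : ℕ}
    (p : Fin m → X) (α : Fin m → ℝ) (ρ : ℝ) : Set (Measure X) :=
  {σ | ∃ (J : Finset X) (t : X → ℝ), (∀ q ∈ J, 0 ≤ t q) ∧ (∑ q ∈ J, t q = 1) ∧
    4 * Real.pi * (∑ q ∈ J, wchi p α q) < ρ ∧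
    σ = ∑ q ∈ J, ENNReal.ofReal (t q) • Measure.dirac q}

theorem wchi_p {X : Type*} {m : ℕ} (p : Fin m → X) (hp : Function.Injective p)
    (α : Fin m → ℝ) (i : Fin m) : wchi p α (p i) = 1 + α i := by
  simp [wchi, hp.eq_iff]

theorem wchi_not {X : Type*} {m : ℕ} (p : Fin m → X)
    (α : Fin m → ℝ) (q : X) (hq : q ∉ Set.range p) : wchi p α q = 1 := by
  have : ∀ i, p i ≠ q := fun i h => hq ⟨i, h⟩
  simp [wchi, this]

theorem wchi_pos {X : Type*} {m : ℕ} (p : Fin m → X) (hp : Function.Injective p)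
    (α : Fin m → ℝ) (hα : ∀ i, α i ∈ Set.Ioo (-1 : ℝ) 0) (q : X) : 0 < wchi p α q := by
  by_cases hq : q ∈ Set.range p
  · obtain ⟨i, rfl⟩ := hq
    rw [wchi_p p hp]
    linarith [(hα i).1]
  · rw [wchi_not p α q hq]
    norm_num

theorem sum_wchi {X : Type*} {m : ℕ} (p : Fin m → X) (hp : Function.Injective p)
    (α : Fin m → ℝ) (K : Finset X) (hK : ∀ q ∈ K, q ∉ Set.range p) (I : Finset (Fin m)) :
    ∑ q ∈ K ∪ I.image p, wchi p α q = (K.card : ℝ) + ∑ i ∈ I, (1 + α i) := by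
  rw [Finset.sum_union, Finset.sum_image (fun a _ b _ h => hp h)]
  · congr 1
    · rw [Finset.sum_congr rfl (fun q hq => wchi_not p α q (hK q hq))]
      simp
    · exact Finset.sum_congr rfl (fun i _ => wchi_p p hp α i)
  · rw [Finset.disjoint_left]
    intro q hq hq'
    obtain ⟨i, _, rfl⟩ := Finset.mem_image.1 hq'
    exact hK _ hq ⟨i, rfl⟩

theorem bary_singleton {X : Type*} [MeasurableSpace X] [MeasurableSingletonClass X]
    (J : Finset X) (t : X → ℝ) (x : X) :
    (∑ q ∈ J, ENNReal.ofReal (t q) • Measure.dirac q : Measure X) {x} =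
      if x ∈ J then ENNReal.ofReal (t x) else 0 := by
  simp [Measure.finsetSum_apply, Set.indicator_apply]

/-- equivalence of the two conditions in the paper's Definition 1.4 of
`p_j`-stability. -/
theorem pStable_measure_iff_algebraic {X : Type*} [MetricSpace X] [MeasurableSpace X]
    [BorelSpace X] [Infinite X] {m : ℕ} (hm : 0 < m) (p : Fin m → X)
    (hp : Function.Injective p) (α : Fin m → ℝ) (hα : ∀ i, α i ∈ Set.Ioo (-1 : ℝ) 0)
    (ρ : ℝ) (hρ : 0 < ρ) (j : Fin m) :
    (∀ σ ∈ formalBarycenters p α ρ, ∀ t ∈ Set.Icc (0 : ℝ) 1,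
        ENNReal.ofReal (1 - t) • σ + ENNReal.ofReal t • Measure.dirac (p j) ∈
          formalBarycenters p α ρ) ↔
      (∀ (k : ℕ) (I : Finset (Fin m)), 0 < k + I.card →
        4 * Real.pi * ((k : ℝ) + ∑ i ∈ I, (1 + α i)) < ρ →
        4 * Real.pi * ((k : ℝ) + ∑ i ∈ insert j I, (1 + α i)) < ρ) := by
  constructor
  · intro H k I hkI hlt
    obtain ⟨K, hKsub, hKc⟩ :=
      ((Set.finite_range p).infinite_compl).exists_subset_card_eq k
    have hK : ∀ q ∈ K, q ∉ Set.range p := fun q hq => hKsub hq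
    have hsum := sum_wchi p hp α K hK
    set J := K ∪ I.image p with hJ
    have hJne : J.Nonempty := by
      by_contra h
      rw [Finset.not_nonempty_iff_eq_empty] at h
      have h1 : K = ∅ := (Finset.union_eq_empty.1 h).1
      have h2 : I = ∅ := Finset.image_eq_empty.1 (Finset.union_eq_empty.1 h).2
      subst h1 h2
      simp at hKc hkI
      omega
    have hc : (0 : ℝ) < J.card := by exact_mod_cast hJne.card_pos
    have hmem : (∑ q ∈ J, ENNReal.ofReal ((fun _ : X => (J.card : ℝ)⁻¹) q) • Measure.dirac q)
        ∈ formalBarycenters p α ρ := by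
      refine ⟨J, fun _ => (J.card : ℝ)⁻¹, fun q _ => by positivity, ?_, ?_, rfl⟩
      · simp [hc.ne']
      · rw [hJ, hsum I, hKc]
        exact hlt
    obtain ⟨J', t', -, -, hlt', heq⟩ := H _ hmem (1/2) ⟨by norm_num, by norm_num⟩
    have hsub : K ∪ (insert j I).image p ⊆ J' := by
      intro x hx
      by_contra hx'
      have h1 := congrArg (fun μ : Measure X => μ {x}) heq
      simp only [Measure.add_apply, Measure.smul_apply] at h1
      rw [bary_singleton, bary_singleton, if_neg hx'] at h1
      have hx2 : x ∈ J ∨ x = p j := by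
        simp only [hJ, Finset.mem_union, Finset.mem_image, Finset.mem_insert] at hx ⊢
        rcases hx with h | ⟨i, rfl | h, rfl⟩
        · exact Or.inl (Or.inl h)
        · exact Or.inr rfl
        · exact Or.inl (Or.inr ⟨i, h, rfl⟩)
      rw [add_eq_zero] at h1
      rcases hx2 with h | rfl
      · have h2 := h1.1
        rw [if_pos h, smul_eq_mul, mul_eq_zero, ENNReal.ofReal_eq_zero,
          ENNReal.ofReal_eq_zero] at h2
        have := inv_pos.2 hc
        rcases h2 with h2 | h2
        · norm_num at h2
        · linarith
      · have h2 := h1.2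
        simp at h2
        try norm_num at h2
    have hle := Finset.sum_le_sum_of_subset_of_nonneg hsub
      (fun q _ _ => (wchi_pos p hp α hα q).le)
    rw [hsum, hKc] at hle
    have := mul_le_mul_of_nonneg_left hle (by positivity : 0 ≤ 4 * Real.pi)
    linarith
  · rintro H σ ⟨J, s, hs, hs1, hlt, rfl⟩ t ⟨ht0, ht1⟩
    set K := J.filter (fun q => q ∉ Set.range p) with hKdef
    set I := Finset.univ.filter (fun i => p i ∈ J) with hIdef
    have hK : ∀ q ∈ K, q ∉ Set.range p := fun q hq => (Finset.mem_filter.1 hq).2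
    have hsum := sum_wchi p hp α K hK
    have hJ : J = K ∪ I.image p := by
      ext q
      simp only [hKdef, hIdef, Finset.mem_union, Finset.mem_filter, Finset.mem_image,
        Finset.mem_univ, true_and]
      constructor
      · intro h
        by_cases hq : q ∈ Set.range p
        · obtain ⟨i, rfl⟩ := hq
          exact Or.inr ⟨i, h, rfl⟩
        · exact Or.inl ⟨h, hq⟩
      · rintro (h | ⟨i, h, rfl⟩)
        · exact h.1
        · exact h
    have hJ' : insert (p j) J = K ∪ (insert j I).image p := by
      rw [Finset.image_insert, Finset.union_insert, ← hJ]
    have hpos : 0 < K.card + I.card := by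
      by_contra h
      have h1 : K = ∅ := Finset.card_eq_zero.1 (by omega)
      have h2 : I = ∅ := Finset.card_eq_zero.1 (by omega)
      rw [hJ, h1, h2] at hs1
      simp at hs1
    have hJs : ∑ q ∈ J, wchi p α q = (K.card : ℝ) + ∑ i ∈ I, (1 + α i) := by
      rw [← hsum I, ← hJ]
    have hnew := H K.card I hpos (by rw [← hJs]; exact hlt)
    have hsJ : ∀ q, 0 ≤ (if q ∈ J then s q else 0) := by
      intro q
      split_ifs with h
      · exact hs q h
      · exact le_rfl
    have hpt : ∀ q, 0 ≤ (if q = p j then t else 0) := by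
      intro q
      split_ifs
      · exact ht0
      · exact le_rfl
    have h1t : 0 ≤ 1 - t := by linarith
    refine ⟨insert (p j) J, fun q => (1 - t) * (if q ∈ J then s q else 0) +
      (if q = p j then t else 0), fun q _ => add_nonneg (mul_nonneg h1t (hsJ q)) (hpt q),
      ?_, ?_, ?_⟩
    · rw [Finset.sum_add_distrib, ← Finset.mul_sum, Finset.sum_ite_mem,
        Finset.inter_eq_right.2 (Finset.subset_insert _ _), hs1]
      simp
    · rw [hJ', hsum]
      exact hnew
    · have e1 : ∀ q, ENNReal.ofReal ((1 - t) * (if q ∈ J then s q else 0) +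
          (if q = p j then t else 0)) • Measure.dirac q =
          ENNReal.ofReal (1 - t) • (if q ∈ J then ENNReal.ofReal (s q) • Measure.dirac q else 0)
          + (if q = p j then ENNReal.ofReal t • Measure.dirac q else 0) := by
        intro q
        rw [ENNReal.ofReal_add (mul_nonneg h1t (hsJ q)) (hpt q), ENNReal.ofReal_mul h1t,
          add_smul, mul_smul]
        congr 1
        · split_ifs <;> simp
        · split_ifs <;> simp
      simp only [e1]
      rw [Finset.sum_add_distrib, ← Finset.smul_sum, Finset.sum_ite_mem,
        Finset.inter_eq_right.2 (Finset.subset_insert _ _)]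
      congr 1
      rw [Finset.sum_ite_eq']
      simp
end

section
/- Fix an index j ∈ Fin m. The configuration (ρ,α) is p_j-stable if and only if every admissible pair (k,I) that is maximal among admissible pairs with respect to the order ⪯ satisfies j ∈ I. -/
open Finset

/-- A pair `(k, I)` is admissible if `k + card I > 0` and `4π·w(k,I) < ρ`. -/
def Admissible {m : ℕ} (α : Fin m → ℝ) (ρ : ℝ) (P : ℕ × Finset (Fin m)) : Prop :=
  0 < P.1 + P.2.card ∧ 4 * Real.pi * wgt α P.1 P.2 < ρ

/-- The order among strata: `(k₁,I₁) ⪯ (k₂,I₂)` iff `k₁ ≤ k₂` and `card (I₁ \ I₂) ≤ k₂ - k₁`. -/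
def StrataLE {m : ℕ} (P Q : ℕ × Finset (Fin m)) : Prop :=
  P.1 ≤ Q.1 ∧ (P.2 \ Q.2).card ≤ Q.1 - P.1

/-- An admissible pair is maximal if no admissible pair lies strictly above it. -/
def MaximalPair {m : ℕ} (α : Fin m → ℝ) (ρ : ℝ) (P : ℕ × Finset (Fin m)) : Prop :=
  Admissible α ρ P ∧ ∀ Q, Admissible α ρ Q → StrataLE P Q → StrataLE Q P

theorem strataLE_trans {m : ℕ} {P Q R : ℕ × Finset (Fin m)} (h : StrataLE P Q)
    (h' : StrataLE Q R) : StrataLE P R := by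
  obtain ⟨a, b⟩ := h
  obtain ⟨c, d⟩ := h'
  refine ⟨a.trans c, ?_⟩
  have h1 : P.2 \ R.2 ⊆ (P.2 \ Q.2) ∪ (Q.2 \ R.2) := by
    intro x hx
    simp only [mem_union, mem_sdiff] at *
    tauto
  have h2 := (card_le_card h1).trans (card_union_le _ _)
  omega

theorem exists_maximal_above {m : ℕ} (α : Fin m → ℝ)
    (hα : ∀ i, α i ∈ Set.Ioo (-1 : ℝ) 0) (ρ : ℝ) (P : ℕ × Finset (Fin m))
    (hP : Admissible α ρ P) : ∃ Q, MaximalPair α ρ Q ∧ StrataLE P Q := by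
  have hfin : {Q | Admissible α ρ Q ∧ StrataLE P Q}.Finite := by
    obtain ⟨N, hN⟩ := exists_nat_gt ρ
    refine Set.Finite.subset ((Set.finite_Iic N).prod (Set.finite_univ)) ?_
    rintro ⟨k, I⟩ ⟨⟨-, h⟩, -⟩
    refine ⟨?_, Set.mem_univ _⟩
    simp only [wgt] at h
    have hs : 0 ≤ ∑ i ∈ I, (1 + α i) := sum_nonneg fun i _ => by linarith [(hα i).1]
    have hk0 : (0 : ℝ) ≤ k := Nat.cast_nonneg k
    have hk : (k : ℝ) < N := by nlinarith [Real.pi_gt_three]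
    exact Set.mem_Iic.2 (by exact_mod_cast hk.le)
  obtain ⟨Q, ⟨hQ, hPQ⟩, hmax⟩ := Set.exists_max_image _
    (fun Q : ℕ × Finset (Fin m) => Q.1 * (m + 1) + Q.2.card) hfin
    ⟨P, hP, le_refl _, by simp⟩
  refine ⟨Q, ⟨hQ, fun R hR hQR => ?_⟩, hPQ⟩
  have h := hmax R ⟨hR, strataLE_trans hPQ hQR⟩
  obtain ⟨h1, h2⟩ := hQR
  have hc : Q.2.card ≤ m := by simpa using card_le_univ Q.2
  have h3 : R.1 = Q.1 := by
    by_contra hne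
    have : Q.1 + 1 ≤ R.1 := by omega
    nlinarith
  rw [h3] at h h2
  have hsub : Q.2 ⊆ R.2 := by
    rw [← sdiff_eq_empty_iff_subset, ← card_eq_zero]; omega
  have heq : Q.2 = R.2 := eq_of_subset_of_card_le hsub (by omega)
  exact ⟨h3.le, by simp [heq]⟩

/-- paper's Facts 6 and 7: `(ρ,α)` is `p_j`-stable iff every maximal
admissible pair `(k, I)` satisfies `j ∈ I`. -/
theorem pStable_iff_mem_of_maximal {m : ℕ} (hm : 0 < m) (α : Fin m → ℝ)
    (hα : ∀ i, α i ∈ Set.Ioo (-1 : ℝ) 0) (ρ : ℝ) (hρ : 0 < ρ) (j : Fin m) :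
    pStable α ρ j ↔
      ∀ (k : ℕ) (I : Finset (Fin m)), MaximalPair α ρ (k, I) → j ∈ I := by
  constructor
  · intro hst k I ⟨⟨h1, h2⟩, hmax⟩
    have h := hmax (k, insert j I)
      ⟨lt_of_lt_of_le h1 (by simpa using card_le_card (subset_insert j I)), hst k I h1 h2⟩
      ⟨le_refl _, by simp [sdiff_eq_empty_iff_subset.2 (subset_insert j I)]⟩
    have h3 := h.2
    simp only [Nat.sub_self, Nat.le_zero, card_eq_zero, sdiff_eq_empty_iff_subset] at h3
    exact h3 (mem_insert_self j I)
  · intro H k I h1 h2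
    by_cases hj : j ∈ I
    · rwa [insert_eq_of_mem hj]
    obtain ⟨⟨K, J⟩, hM, hkK, hc⟩ := exists_maximal_above α hα ρ (k, I) ⟨h1, h2⟩
    have hjJ := H K J hM
    have hlt := hM.1.2
    simp only at hkK hc hlt
    refine lt_of_le_of_lt (mul_le_mul_of_nonneg_left ?_ (by positivity)) hlt
    simp only [wgt]
    have hA : ∑ i ∈ insert j I, (1 + α i) ≤ ∑ i ∈ (I \ J) ∪ J, (1 + α i) := by
      refine sum_le_sum_of_subset_of_nonneg ?_ fun i _ _ => by linarith [(hα i).1]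
      rw [sdiff_union_self_eq_union]
      intro x hx
      rcases mem_insert.1 hx with rfl | hx
      · exact mem_union_right _ hjJ
      · exact mem_union_left _ hx
    rw [sum_union sdiff_disjoint] at hA
    have hB : ∑ i ∈ I \ J, (1 + α i) ≤ ((I \ J).card : ℝ) := by
      have := sum_le_card_nsmul (I \ J) (fun i => 1 + α i) 1
        fun i _ => by linarith [(hα i).2]
      simpa using this
    have hC : k + (I \ J).card ≤ K := by omega
    have hD : (k : ℝ) + ((I \ J).card : ℝ) ≤ K := by exact_mod_cast hC
    linarith
end

section
/- The relation ⪯ on ℕ × Finset(Fin m), defined by (k₁,I₁) ⪯ (k₂,I₂) iff k₁ ≤ k₂ and card(I₁ \ I₂) ≤ k₂ − k₁, is a partial order: it is reflexive, transitive, and antisymmetric. -/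
open Finset

/-- paper's Definition 2.1: the relation `⪯` on `ℕ × Finset (Fin m)` is a
partial order: reflexive, transitive and antisymmetric. -/
theorem strataLE_partialOrder (m : ℕ) (hm : 0 < m) :
    Reflexive (StrataLE (m := m)) ∧ Transitive (StrataLE (m := m)) ∧
      AntiSymmetric (StrataLE (m := m)) := by
  refine ⟨?_, ?_, ?_⟩
  · intro P
    simp [StrataLE]
  · rintro P Q R ⟨h1, h2⟩ ⟨h3, h4⟩
    refine ⟨h1.trans h3, ?_⟩
    have hsub : P.2 \ R.2 ⊆ (P.2 \ Q.2) ∪ (Q.2 \ R.2) := by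
      intro x hx
      simp only [Finset.mem_union, Finset.mem_sdiff] at hx ⊢
      tauto
    have h5 := Finset.card_le_card hsub
    have h6 := Finset.card_union_le (P.2 \ Q.2) (Q.2 \ R.2)
    omega
  · rintro P Q ⟨h1, h2⟩ ⟨h3, h4⟩
    have h5 : (P.2 \ Q.2).card = 0 := by omega
    have h6 : (Q.2 \ P.2).card = 0 := by omega
    rw [Finset.card_eq_zero, Finset.sdiff_eq_empty_iff_subset] at h5 h6
    exact Prod.ext (le_antisymm h1 h3) (Finset.Subset.antisymm h5 h6)
end

section
/- Let X be an infinite metric space and p : Fin m → X injective. For all k₁, k₂ ∈ ℕ and finite I₁, I₂ ⊆ Fin m, the inclusion of strata Σ^{k₁,I₁} ⊆ Σ^{k₂,I₂} holds if and only if (k₁,I₁) ⪯ (k₂,I₂), i.e. if and only if k₁ ≤ k₂ and card(I₁ \ I₂) ≤ k₂ − k₁. -/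
open Finset MeasureTheory

/-- The stratum `Σ^{k,I}`: probability measures of the form
`∑_{i∈I} s i · δ_{p i} + ∑_{j=1}^{k} t j · δ_{q j}`. -/
noncomputable def stratum {X : Type*} [MeasurableSpace X] {m : ℕ} (p : Fin m → X)
    (k : ℕ) (I : Finset (Fin m)) : Set (Measure X) :=
  {σ | ∃ (s : Fin m → ℝ) (t : Fin k → ℝ) (q : Fin k → X),
    (∀ i, 0 ≤ s i) ∧ (∀ j, 0 ≤ t j) ∧ ((∑ i ∈ I, s i) + ∑ j, t j = 1) ∧
    σ = (∑ i ∈ I, ENNReal.ofReal (s i) • Measure.dirac (p i)) +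
        ∑ j, ENNReal.ofReal (t j) • Measure.dirac (q j)}

lemma sum_split_aux {M : Type*} [AddCommMonoid M] {m : ℕ} (I J : Finset (Fin m)) (f : Fin m → M) :
    ∑ i ∈ I, f i = (∑ i ∈ J, if i ∈ I then f i else 0) + ∑ i : ↥(I \ J), f i := by
  rw [Finset.sum_coe_sort (I \ J) f, ← Finset.sum_filter, ← Finset.sum_inter_add_sum_sdiff I J]
  congr 2
  ext i
  simp [and_comm]

lemma mem_of_mass_aux {X : Type*} [MetricSpace X] [MeasurableSpace X] [BorelSpace X]
    {m k : ℕ} {p : Fin m → X} {I : Finset (Fin m)} {σ : Measure X}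
    {x : X} (hx : σ {x} ≠ 0) (hI : ∀ i ∈ I, p i ≠ x)
    (t : Fin k → ℝ) (q : Fin k → X) (s : Fin m → ℝ)
    (hσ : σ = (∑ i ∈ I, ENNReal.ofReal (s i) • Measure.dirac (p i)) +
        ∑ j, ENNReal.ofReal (t j) • Measure.dirac (q j)) : ∃ j, q j = x := by
  by_contra! hq
  apply hx
  rw [hσ]
  simp only [Measure.coe_add, Pi.add_apply, Measure.coe_finset_sum, Finset.sum_apply,
    Measure.smul_apply, smul_eq_mul, add_eq_zero]
  constructor
  · refine Finset.sum_eq_zero fun i hi => ?_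
    rw [Measure.dirac_apply' _ (measurableSet_singleton x)]
    simp [hI i hi]
  · refine Finset.sum_eq_zero fun j _ => ?_
    rw [Measure.dirac_apply' _ (measurableSet_singleton x)]
    simp [hq j]

/-- paper's Definition 2.1: inclusion of strata `Σ^{k₁,I₁} ⊆ Σ^{k₂,I₂}` holds
iff `k₁ ≤ k₂` and `card (I₁ \ I₂) ≤ k₂ - k₁`. -/
theorem stratum_subset_iff {X : Type*} [MetricSpace X] [MeasurableSpace X] [BorelSpace X]
    [Infinite X] {m : ℕ} (hm : 0 < m) (p : Fin m → X) (hp : Function.Injective p)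
    (α : Fin m → ℝ) (hα : ∀ i, α i ∈ Set.Ioo (-1 : ℝ) 0)
    (k₁ k₂ : ℕ) (I₁ I₂ : Finset (Fin m)) :
    stratum p k₁ I₁ ⊆ stratum p k₂ I₂ ↔ k₁ ≤ k₂ ∧ (I₁ \ I₂).card ≤ k₂ - k₁ := by
  classical
  constructor
  · intro h
    by_cases hN : I₁.card + k₁ = 0
    · have h1 : I₁ = ∅ := by rw [← Finset.card_eq_zero]; omega
      have h2 : k₁ = 0 := by omega
      subst h1 h2
      simp
    have hNpos : (0 : ℝ) < (I₁.card + k₁ : ℕ) := by exact_mod_cast Nat.pos_of_ne_zero hN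
    -- points outside the range of p
    have hinf : (Set.range p)ᶜ.Infinite := (Set.finite_range p).infinite_compl
    obtain ⟨Q, hQ, hQc⟩ := hinf.exists_subset_card_eq k₁
    let e := Q.equivFinOfCardEq hQc
    let q : Fin k₁ → X := fun j => (e.symm j : X)
    have hqinj : Function.Injective q := Subtype.val_injective.comp e.symm.injective
    have hqp : ∀ j i, p i ≠ q j := fun j i hij => hQ (e.symm j).2 ⟨i, hij⟩
    let c : ℝ := ((I₁.card + k₁ : ℕ) : ℝ)⁻¹
    have hc : 0 < c := inv_pos.mpr hNpos
    let σ : Measure X := (∑ i ∈ I₁, ENNReal.ofReal c • Measure.dirac (p i)) +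
        ∑ j, ENNReal.ofReal c • Measure.dirac (q j)
    have hσ : σ ∈ stratum p k₁ I₁ := by
      refine ⟨fun _ => c, fun _ => c, q, fun _ => hc.le, fun _ => hc.le, ?_, rfl⟩
      simp only [Finset.sum_const, Finset.card_univ, Fintype.card_fin, nsmul_eq_mul, ← add_mul]
      rw [← Nat.cast_add]
      exact mul_inv_cancel₀ hNpos.ne'
    have hcne : ENNReal.ofReal c ≠ 0 := by simpa using hc
    have hm1 : ∀ i ∈ I₁, σ {p i} ≠ 0 := by
      intro i hi h0
      simp only [σ, Measure.coe_add, Pi.add_apply, Measure.coe_finset_sum, Finset.sum_apply,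
        Measure.smul_apply, smul_eq_mul, add_eq_zero, Finset.sum_eq_zero_iff] at h0
      have := h0.1 i hi
      simp [hc.not_ge] at this
    have hm2 : ∀ j, σ {q j} ≠ 0 := by
      intro j h0
      simp only [σ, Measure.coe_add, Pi.add_apply, Measure.coe_finset_sum, Finset.sum_apply,
        Measure.smul_apply, smul_eq_mul, add_eq_zero, Finset.sum_eq_zero_iff] at h0
      have := h0.2 j (Finset.mem_univ j)
      simp [hc.not_ge] at this
    have hσ2 := h hσ
    obtain ⟨s', t', q', -, -, -, he⟩ := id hσ2
    have key : ∀ y : Fin k₁ ⊕ ↥(I₁ \ I₂), ∃ j, q' j = Sum.elim q (fun i => p i.1) y := by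
      rintro (j | ⟨i, hi⟩)
      · exact mem_of_mass_aux (hm2 j) (fun i _ => hqp j i) t' q' s' he
      · rw [Finset.mem_sdiff] at hi
        refine mem_of_mass_aux (hm1 i hi.1) (fun i' hi' hh => ?_) t' q' s' he
        exact hi.2 (hp hh ▸ hi')
    choose g hg using key
    have hginj : Function.Injective g := by
      have : Function.Injective (Sum.elim q (fun i : ↥(I₁ \ I₂) => p i.1)) :=
        hqinj.sumElim (hp.comp Subtype.val_injective) (fun j i hh => hqp j i hh.symm)
      intro a b hab
      apply this
      rw [← hg, ← hg, hab]
    have := Fintype.card_le_of_injective g hginj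
    simp only [Fintype.card_sum, Fintype.card_fin, Fintype.card_coe] at this
    omega
  · rintro ⟨hk, hcard⟩ σ ⟨s, t, q, hs, ht, hsum, rfl⟩
    obtain ⟨x0⟩ : Nonempty X := inferInstance
    obtain ⟨e⟩ : Nonempty ((Fin k₁ ⊕ ↥(I₁ \ I₂)) ↪ Fin k₂) := by
      apply Function.Embedding.nonempty_of_card_le
      simp only [Fintype.card_sum, Fintype.card_fin, Fintype.card_coe]
      omega
    let T : Fin k₁ ⊕ ↥(I₁ \ I₂) → ℝ := Sum.elim t (fun i => s i.1)
    let Q : Fin k₁ ⊕ ↥(I₁ \ I₂) → X := Sum.elim q (fun i => p i.1)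
    let t' : Fin k₂ → ℝ := Function.extend e T 0
    let q' : Fin k₂ → X := Function.extend e Q (fun _ => x0)
    have ht'e : ∀ y, t' (e y) = T y := fun y => e.injective.extend_apply _ _ _
    have hq'e : ∀ y, q' (e y) = Q y := fun y => e.injective.extend_apply _ _ _
    have ht'0 : ∀ j, j ∉ Set.range e → t' j = 0 := fun j hj =>
      Function.extend_apply' _ _ _ hj
    refine ⟨fun i => if i ∈ I₁ then s i else 0, t', q', ?_, ?_, ?_, ?_⟩
    · intro i
      dsimp only
      split_ifs
      exacts [hs i, le_rfl]
    · intro j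
      by_cases hj : j ∈ Set.range e
      · obtain ⟨y, rfl⟩ := hj
        rw [ht'e]
        rcases y with j | i
        exacts [ht j, hs i]
      · rw [ht'0 j hj]
    · rw [← Fintype.sum_of_injective e e.injective T t' ht'0 (fun y => (ht'e y).symm),
        Fintype.sum_sum_type, ← hsum, sum_split_aux I₁ I₂ s]
      simp only [T, Sum.elim_inl, Sum.elim_inr]
      abel
    · rw [← Fintype.sum_of_injective e e.injective
        (fun y => ENNReal.ofReal (T y) • Measure.dirac (Q y))
        (fun j => ENNReal.ofReal (t' j) • Measure.dirac (q' j))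
        (fun j hj => by simp [ht'0 j hj]) (fun y => by simp only [ht'e, hq'e]),
        Fintype.sum_sum_type,
        sum_split_aux I₁ I₂ (fun i => ENNReal.ofReal (s i) • Measure.dirac (p i))]
      have : ∀ i, (if i ∈ I₁ then ENNReal.ofReal (s i) • Measure.dirac (p i) else 0) =
          ENNReal.ofReal (if i ∈ I₁ then s i else 0) • Measure.dirac (p i) := by
        intro i
        split_ifs <;> simp
      simp only [T, Q, Sum.elim_inl, Sum.elim_inr, this]
      abel
end

section
/- Let X be an infinite metric space and p : Fin m → X injective. For all pairs (k₁,I₁) and (k₂,I₂), a measure σ belongs to Σ^{k₁,I₁} ∩ Σ^{k₂,I₂} if and only if there exists a pair (k,I) with (k,I) ⪯ (k₁,I₁), (k,I) ⪯ (k₂,I₂), and σ ∈ Σ^{k,I}. -/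
open Finset MeasureTheory

theorem stratum_char {X : Type*} [MeasurableSpace X] [MeasurableSingletonClass X]
    [Nonempty X] {m : ℕ} (p : Fin m → X) (hp : Function.Injective p)
    (k : ℕ) (I : Finset (Fin m)) (σ : Measure X) :
    σ ∈ stratum p k I ↔ σ Set.univ = 1 ∧ ∃ T : Set X, T.Finite ∧ T.ncard ≤ k ∧
      σ (T ∪ p '' (I : Set (Fin m)))ᶜ = 0 := by
  classical
  constructor
  · rintro ⟨s, t, q, hs, ht, h1, rfl⟩
    refine ⟨?_, Set.range q, Set.finite_range q, ?_, ?_⟩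
    · simp only [Measure.add_apply, Measure.finsetSum_apply, Measure.smul_apply,
        measure_univ, smul_eq_mul, mul_one]
      rw [← ENNReal.ofReal_sum_of_nonneg (fun i _ => hs i),
        ← ENNReal.ofReal_sum_of_nonneg (fun i _ => ht i),
        ← ENNReal.ofReal_add (Finset.sum_nonneg fun i _ => hs i)
          (Finset.sum_nonneg fun i _ => ht i), h1, ENNReal.ofReal_one]
    · rw [← Set.image_univ]
      refine (Set.ncard_image_le Set.finite_univ).trans ?_
      simp [Set.ncard_univ]
    · have hmeas : MeasurableSet (Set.range q ∪ p '' (I : Set (Fin m)))ᶜ :=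
        ((Set.finite_range q).union ((Finset.finite_toSet I).image p)).measurableSet.compl
      simp only [Measure.add_apply, Measure.finsetSum_apply, Measure.smul_apply, smul_eq_mul,
        Measure.dirac_apply' _ hmeas]
      rw [Finset.sum_eq_zero, Finset.sum_eq_zero, add_zero]
      · intro j _
        rw [Set.indicator_of_notMem, mul_zero]
        exact fun h => h (Or.inl ⟨j, rfl⟩)
      · intro i hi
        rw [Set.indicator_of_notMem, mul_zero]
        exact fun h => h (Or.inr ⟨i, hi, rfl⟩)
  · rintro ⟨h1, T₀, hT₀, hk₀, h0⟩
    obtain ⟨T, hTI, hk, hT⟩ : ∃ T : Finset X, Disjoint (I.image p) T ∧ T.card ≤ k ∧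
        σ (((I.image p ∪ T : Finset X)) : Set X)ᶜ = 0 := by
      refine ⟨hT₀.toFinset \ I.image p, Finset.disjoint_sdiff, ?_, ?_⟩
      · refine (Finset.card_le_card Finset.sdiff_subset).trans ?_
        rwa [← Set.ncard_eq_toFinset_card T₀ hT₀]
      · convert h0 using 3
        ext x
        simp [or_comm]
    have hfin : IsFiniteMeasure σ := ⟨by rw [h1]; simp⟩
    have hσ : σ = ∑ x ∈ I.image p ∪ T, σ {x} • Measure.dirac x := by
      ext A hA
      have e1 : σ A = σ (A ∩ (I.image p ∪ T : Finset X)) := by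
        have hd : σ (A \ (I.image p ∪ T : Finset X)) = 0 :=
          measure_mono_null (fun x hx => hx.2) hT
        rw [← measure_inter_add_sdiff A (Finset.measurableSet (I.image p ∪ T)), hd, add_zero]
      have e2 : A ∩ (I.image p ∪ T : Finset X) =
          (((I.image p ∪ T).filter (· ∈ A) : Finset X) : Set X) := by
        ext x; rw [Finset.coe_filter]; exact and_comm
      rw [e1, e2, ← sum_measure_singleton, Finset.sum_filter]
      simp only [Measure.finsetSum_apply, Measure.smul_apply, smul_eq_mul,
        Measure.dirac_apply' _ hA]
      refine Finset.sum_congr rfl fun x _ => ?_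
      by_cases hx : x ∈ A <;> simp [hx]
    obtain ⟨e⟩ : Nonempty (T ↪ Fin k) :=
      Function.Embedding.nonempty_of_card_le (by simpa using hk)
    have x0 : X := Classical.arbitrary X
    have hsum : ∑ x ∈ I.image p ∪ T, (σ {x}).toReal = 1 := by
      have := congrArg (fun μ => (μ Set.univ).toReal) hσ
      simp only [h1, Measure.finsetSum_apply, Measure.smul_apply, measure_univ, smul_eq_mul,
        mul_one] at this
      rw [ENNReal.toReal_sum (fun x _ => measure_ne_top σ _)] at this
      simpa using this.symm
    have key : ∀ {M : Type _} [AddCommMonoid M] (f : X → M) (g : Fin k → M),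
        (∀ x : T, f x = g (e x)) → (∀ j, j ∉ Set.range e → g j = 0) →
        ∑ x ∈ I.image p ∪ T, f x = ∑ i ∈ I, f (p i) + ∑ j, g j := by
      intro M _ f g hfg hg
      rw [Finset.sum_union hTI, Finset.sum_image (fun _ _ _ _ h => hp h)]
      congr 1
      rw [← Finset.sum_coe_sort T f]
      exact Fintype.sum_of_injective e e.injective _ _ hg hfg
    refine ⟨fun i => (σ {p i}).toReal, Function.extend e (fun x => (σ {x.1}).toReal) 0,
      Function.extend e (fun x => x.1) (fun _ => x0), fun _ => ENNReal.toReal_nonneg, ?_, ?_, ?_⟩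
    · intro j
      by_cases hj : ∃ x, e x = j
      · obtain ⟨x, rfl⟩ := hj
        rw [e.injective.extend_apply]; exact ENNReal.toReal_nonneg
      · rw [Function.extend_apply' _ _ _ hj]; rfl
    · rw [← hsum, Finset.sum_union hTI, Finset.sum_image (fun _ _ _ _ h => hp h)]
      congr 1
      rw [← Finset.sum_coe_sort T]
      symm
      refine Fintype.sum_of_injective e e.injective _ _ ?_ ?_
      · intro j hj
        rw [Function.extend_apply' _ _ _ hj]; rfl
      · intro x
        rw [e.injective.extend_apply]
    · conv_lhs => rw [hσ]
      rw [key (fun x => σ {x} • Measure.dirac x) (fun j =>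
        ENNReal.ofReal (Function.extend e (fun x => (σ {x.1}).toReal) 0 j) •
        Measure.dirac (Function.extend e (fun x => x.1) (fun _ => x0) j))]
      · congr 1
        refine Finset.sum_congr rfl fun i _ => ?_
        rw [ENNReal.ofReal_toReal (measure_ne_top σ _)]
      · intro x
        rw [e.injective.extend_apply, e.injective.extend_apply,
          ENNReal.ofReal_toReal (measure_ne_top σ _)]
      · intro j hj
        rw [Function.extend_apply' _ _ _ hj]
        simp

theorem stratum_mono_of_le {X : Type*} [MeasurableSpace X] [MeasurableSingletonClass X]
    [Nonempty X] {m : ℕ} (p : Fin m → X) (hp : Function.Injective p)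
    {k k₁ : ℕ} {I I₁ : Finset (Fin m)} {σ : Measure X} (h : StrataLE (k, I) (k₁, I₁))
    (hσ : σ ∈ stratum p k I) : σ ∈ stratum p k₁ I₁ := by
  classical
  rw [stratum_char p hp] at hσ ⊢
  obtain ⟨h1, T, hT, hk, h0⟩ := hσ
  obtain ⟨hle, hc⟩ := h
  simp only at hle hc
  refine ⟨h1, T ∪ p '' ((I \ I₁ : Finset (Fin m)) : Set (Fin m)),
    hT.union ((Finset.finite_toSet _).image p), ?_, ?_⟩
  · refine (Set.ncard_union_le _ _).trans ?_
    rw [Set.ncard_image_of_injective _ hp, Set.ncard_coe_finset]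
    omega
  · refine measure_mono_null (Set.compl_subset_compl.2 ?_) h0
    rintro x (hx | ⟨i, hi, rfl⟩)
    · exact Or.inl (Or.inl hx)
    · by_cases h : i ∈ I₁
      · exact Or.inr ⟨i, h, rfl⟩
      · exact Or.inl (Or.inr ⟨i, by simpa using ⟨hi, h⟩, rfl⟩)

theorem strataLE_support {X : Type*} [MeasurableSpace X]
    {m : ℕ} (p : Fin m → X) (hp : Function.Injective p)
    {k₁ : ℕ} {I J : Finset (Fin m)} {S T : Set X} (hT : T.Finite) (hk : T.ncard ≤ k₁)
    (hS : S ⊆ T ∪ p '' (I : Set (Fin m))) (hJ : ∀ i, i ∈ J ↔ p i ∈ S) :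
    StrataLE ((S \ Set.range p).ncard, J) (k₁, I) := by
  classical
  have hd : Disjoint (S \ Set.range p) (p '' ((J \ I : Finset (Fin m)) : Set (Fin m))) := by
    rw [Set.disjoint_left]
    rintro x ⟨_, hx⟩ ⟨i, _, rfl⟩
    exact hx ⟨i, rfl⟩
  have hsub : (S \ Set.range p) ∪ (p '' ((J \ I : Finset (Fin m)) : Set (Fin m))) ⊆ T := by
    rintro x (⟨hx, hn⟩ | ⟨i, hi, rfl⟩)
    · rcases hS hx with h | ⟨i, _, rfl⟩
      · exact h
      · exact absurd ⟨i, rfl⟩ hn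
    · simp only [Finset.coe_sdiff, Set.mem_sdiff, Finset.mem_coe] at hi
      rcases hS ((hJ i).1 hi.1) with h | ⟨j, hj, hji⟩
      · exact h
      · exact absurd (hp hji ▸ hj) hi.2
  have hc := Set.ncard_le_ncard hsub hT
  rw [Set.ncard_union_eq hd (hT.subset (Set.subset_union_left.trans hsub))
    ((Finset.finite_toSet _).image p), Set.ncard_image_of_injective _ hp,
    Set.ncard_coe_finset] at hc
  constructor <;> simp only <;> omega

/-- paper's Fact 2: `σ ∈ Σ^{k₁,I₁} ∩ Σ^{k₂,I₂}` iff `σ` lies in a stratum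
`Σ^{k,I}` with `(k,I) ⪯ (k₁,I₁)` and `(k,I) ⪯ (k₂,I₂)`. -/
theorem mem_stratum_inter_iff {X : Type*} [MetricSpace X] [MeasurableSpace X] [BorelSpace X]
    [Infinite X] {m : ℕ} (hm : 0 < m) (p : Fin m → X) (hp : Function.Injective p)
    (α : Fin m → ℝ) (hα : ∀ i, α i ∈ Set.Ioo (-1 : ℝ) 0)
    (k₁ k₂ : ℕ) (I₁ I₂ : Finset (Fin m)) (σ : Measure X) :
    σ ∈ stratum p k₁ I₁ ∩ stratum p k₂ I₂ ↔
      ∃ (k : ℕ) (I : Finset (Fin m)), StrataLE (k, I) (k₁, I₁) ∧ StrataLE (k, I) (k₂, I₂) ∧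
        σ ∈ stratum p k I := by
  classical
  constructor
  · rintro ⟨h₁, h₂⟩
    rw [stratum_char p hp] at h₁ h₂
    obtain ⟨h1, T₁, hT₁, hk₁, h01⟩ := h₁
    obtain ⟨-, T₂, hT₂, hk₂, h02⟩ := h₂
    have hsub : ∀ F : Set X, σ Fᶜ = 0 → {x | σ {x} ≠ 0} ⊆ F := by
      intro F hF x hx
      by_contra hxF
      exact hx (measure_mono_null (Set.singleton_subset_iff.2 hxF) hF)
    have hF₁ : (T₁ ∪ p '' (I₁ : Set (Fin m))).Finite :=
      hT₁.union ((Finset.finite_toSet _).image p)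
    have hS : σ {x | σ {x} ≠ 0}ᶜ = 0 := by
      have hc : σ ((T₁ ∪ p '' (I₁ : Set (Fin m))) ∩ {x | σ {x} = 0}) = 0 := by
        have hf := hF₁.inter_of_left {x | σ {x} = 0}
        rw [← Set.biUnion_of_singleton ((T₁ ∪ p '' (I₁ : Set (Fin m))) ∩ {x | σ {x} = 0}),
          measure_biUnion_null_iff hf.countable]
        exact fun x hx => hx.2
      refine measure_mono_null ?_ (measure_union_null hc h01)
      intro x hx
      by_cases h : x ∈ T₁ ∪ p '' (I₁ : Set (Fin m))
      · exact Or.inl ⟨h, by simpa using hx⟩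
      · exact Or.inr h
    refine ⟨_, Finset.univ.filter (fun i => p i ∈ {x | σ {x} ≠ 0}),
      strataLE_support p hp hT₁ hk₁ (hsub _ h01) (by simp),
      strataLE_support p hp hT₂ hk₂ (hsub _ h02) (by simp), ?_⟩
    rw [stratum_char p hp]
    refine ⟨h1, _, (hF₁.subset (hsub _ h01)).sdiff, le_rfl, ?_⟩
    refine measure_mono_null (Set.compl_subset_compl.2 ?_) hS
    intro x hx
    by_cases h : x ∈ Set.range p
    · obtain ⟨i, rfl⟩ := h
      exact Or.inr ⟨i, by simpa using hx, rfl⟩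
    · exact Or.inl ⟨hx, h⟩
  · rintro ⟨k, I, h₁, h₂, h⟩
    exact ⟨stratum_mono_of_le p hp h₁ h, stratum_mono_of_le p hp h₂ h⟩
end

section
/- Let X be an infinite metric space, p : Fin m → X injective, and fix k ∈ ℕ and a finite I ⊆ Fin m with k + card(I) > 0, and an index i ∈ Fin m. Then the stratum Σ^{k,I} is p_i-stable — that is, for every σ ∈ Σ^{k,I} and every t ∈ [0,1] the measure (1−t)·σ + t·δ_{p i} belongs to Σ^{k,I} — if and only if i ∈ I. -/
open Finset MeasureTheory

/-- second assertion of the paper's Fact 6: a stratum `Σ^{k,I}` is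
`p_i`-stable iff `i ∈ I`. -/
theorem stratum_pStable_iff {X : Type*} [MetricSpace X] [MeasurableSpace X] [BorelSpace X]
    [Infinite X] {m : ℕ} (hm : 0 < m) (p : Fin m → X) (hp : Function.Injective p)
    (α : Fin m → ℝ) (hα : ∀ i, α i ∈ Set.Ioo (-1 : ℝ) 0)
    (k : ℕ) (I : Finset (Fin m)) (hkI : 0 < k + I.card) (i : Fin m) :
    (∀ σ ∈ stratum p k I, ∀ t ∈ Set.Icc (0 : ℝ) 1,
        ENNReal.ofReal (1 - t) • σ + ENNReal.ofReal t • Measure.dirac (p i) ∈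
          stratum p k I) ↔ i ∈ I := by
  constructor
  · intro h
    by_contra hi
    have hinf : (Set.range p)ᶜ.Infinite := (Set.finite_range p).infinite_compl
    let e0 := hinf.natEmbedding
    let e : Fin k → X := fun j => (e0 j.val : X)
    have he : Function.Injective e := by
      intro a b hab
      exact Fin.ext (e0.injective (Subtype.ext hab))
    have hep : ∀ j l, e j ≠ p l := by
      intro j l hjl
      exact (e0 j.val).2 ⟨l, hjl.symm⟩
    have hc : (0 : ℝ) < (k : ℝ) + I.card := by exact_mod_cast hkI
    let c : ℝ := ((k : ℝ) + I.card)⁻¹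
    have hcpos : 0 < c := inv_pos.mpr hc
    have key := h ((∑ i ∈ I, ENNReal.ofReal c • Measure.dirac (p i)) +
        ∑ j, ENNReal.ofReal c • Measure.dirac (e j))
      ⟨fun _ => c, fun _ => c, e, fun _ => hcpos.le, fun _ => hcpos.le, by
        simp only [Finset.sum_const, Finset.card_univ, Fintype.card_fin, nsmul_eq_mul]
        rw [← add_mul, add_comm]
        exact mul_inv_cancel₀ hc.ne', rfl⟩ (1/2) ⟨by norm_num, by norm_num⟩
    obtain ⟨s, t, q, -, -, -, hσ⟩ := key
    have hzero : ∀ x : X, (∀ l ∈ I, p l ≠ x) → (∀ j, q j ≠ x) →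
        ((∑ i ∈ I, ENNReal.ofReal (s i) • Measure.dirac (p i)) +
        ∑ j, ENNReal.ofReal (t j) • Measure.dirac (q j)) {x} = 0 := by
      intro x h1 h2
      simp only [Measure.add_apply, Measure.finsetSum_apply, Measure.smul_apply, smul_eq_mul,
        Measure.dirac_apply, add_eq_zero, Finset.sum_eq_zero_iff, mul_eq_zero]
      exact ⟨fun l hl => Or.inr (by simp [h1 l hl]), fun j _ => Or.inr (by simp [h2 j])⟩
    have hq : ∀ o : Option (Fin k), ∃ j, q j = o.elim (p i) e := by
      intro o
      by_contra! hcon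
      have hz := hzero (o.elim (p i) e) (by
        intro l hl
        cases o with
        | none => exact fun hh => hi (hp hh ▸ hl)
        | some j => exact (hep j l).symm) hcon
      rw [← hσ] at hz
      simp only [Measure.add_apply, Measure.finsetSum_apply, Measure.smul_apply, smul_eq_mul,
        Measure.dirac_apply, add_eq_zero, Finset.sum_eq_zero_iff, mul_eq_zero] at hz
      cases o with
      | none =>
        rcases hz.2 with h1 | h1
        · rw [ENNReal.ofReal_eq_zero] at h1
          norm_num at h1
        · simp at h1
      | some j =>
        rcases hz.1 with h1 | h1
        · rw [ENNReal.ofReal_eq_zero] at h1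
          norm_num at h1
        · rcases h1.2 j (Finset.mem_univ j) with h2 | h2
          · rw [ENNReal.ofReal_eq_zero] at h2
            linarith
          · simp at h2
    choose g hg using hq
    have hginj : Function.Injective g := by
      intro a b hab
      have hab2 : a.elim (p i) e = b.elim (p i) e := by rw [← hg, ← hg, hab]
      cases a with
      | none =>
        cases b with
        | none => rfl
        | some j => exact absurd hab2.symm (hep j i)
      | some j =>
        cases b with
        | none => exact absurd hab2 (hep j i)
        | some j2 => exact congrArg some (he hab2)
    have := Fintype.card_le_of_injective g hginj
    simp at this
  · rintro hi σ ⟨s, u, q, hs, hu, hsum, rfl⟩ t ⟨ht0, ht1⟩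
    have h1t : 0 ≤ 1 - t := by linarith
    have hite : ∀ l, 0 ≤ (if l = i then t else 0) := by
      intro l
      split_ifs <;> simp [ht0]
    refine ⟨fun l => (1 - t) * s l + if l = i then t else 0, fun j => (1 - t) * u j, q,
      fun l => add_nonneg (mul_nonneg h1t (hs l)) (hite l),
      fun j => mul_nonneg h1t (hu j), ?_, ?_⟩
    · rw [Finset.sum_add_distrib, ← Finset.mul_sum, ← Finset.mul_sum, Finset.sum_ite_eq',
        if_pos hi]
      linear_combination (1 - t) * hsum
    · have hd : ENNReal.ofReal t • Measure.dirac (p i) =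
          ∑ l ∈ I, ENNReal.ofReal (if l = i then t else 0) • Measure.dirac (p l) := by
        rw [Finset.sum_eq_single i]
        · simp
        · intro b _ hb
          simp [hb]
        · exact fun hh => absurd hi hh
      rw [hd, smul_add, Finset.smul_sum, Finset.smul_sum, add_right_comm,
        ← Finset.sum_add_distrib]
      congr 1
      · refine Finset.sum_congr rfl fun l _ => ?_
        rw [ENNReal.ofReal_add (mul_nonneg h1t (hs l)) (hite l), ENNReal.ofReal_mul h1t,
          add_smul, mul_smul]
      · refine Finset.sum_congr rfl fun l _ => ?_
        rw [ENNReal.ofReal_mul h1t, mul_smul]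
end

section
/- Let δ > 0, C > 0, C' > 0, α ∈ (−1,0), and set λ := C'·e^{−2C}. Let u : ℝ² → ℝ be continuous on the closed ball {|x| ≤ 2δ}, twice continuously differentiable on the punctured open ball {0 < |x| < 2δ}, and suppose that −Δu(x) ≥ C'·(|x|^{2α}·e^{−2C} − 1) for all x with 0 < |x| < 2δ, and that u(x) ≥ −C for all x with |x| = 2δ. Then for every x with |x| ≤ 2δ one has u(x) ≥ −C + (C'/4)·(|x|² − (2δ)²) − (λ/(4(1+α)²))·(|x|^{2+2α} − (2δ)^{2+2α}). -/
open Real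

/-- The Euclidean Laplacian on `ℝ²`: the sum of the two pure second partial derivatives. -/
noncomputable def lap (u : EuclideanSpace ℝ (Fin 2) → ℝ) (x : EuclideanSpace ℝ (Fin 2)) : ℝ :=
  ∑ i : Fin 2, fderiv ℝ (fun y => fderiv ℝ u y (EuclideanSpace.single i 1)) x
    (EuclideanSpace.single i 1)

/-- One-dimensional second order necessary condition at a local minimum. -/
lemma second_deriv_nonneg {g h : ℝ → ℝ} {c : ℝ} (hmin : IsLocalMin g 0)
    (hg : ∀ᶠ t in nhds (0 : ℝ), HasDerivAt g (h t) t) (hh : HasDerivAt h c 0) : 0 ≤ c := by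
  by_contra hc
  push Not at hc
  have hd : deriv g =ᶠ[nhds 0] h := hg.mono fun t ht => ht.deriv
  have hdd : deriv (deriv g) 0 = c := by rw [hd.deriv_eq, hh.deriv]
  have hmax : IsLocalMax g 0 :=
    isLocalMax_of_deriv_deriv_neg (by rw [hdd]; exact hc) hmin.deriv_eq_zero
      hg.self_of_nhds.continuousAt
  have hconst : g =ᶠ[nhds 0] fun _ => g 0 := by
    filter_upwards [hmin, hmax] with t h1 h2
    exact le_antisymm h2 h1
  have h2 : deriv g =ᶠ[nhds 0] deriv (fun _ => g 0) := hconst.deriv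
  have h3 : deriv (deriv g) 0 = 0 := by
    rw [h2.deriv_eq]; simp
  linarith

lemma norm_sq_line (x : EuclideanSpace ℝ (Fin 2)) (i : Fin 2) (t : ℝ) :
    ‖x + t • EuclideanSpace.single i (1 : ℝ)‖ ^ 2 = ‖x‖ ^ 2 + 2 * t * x i + t ^ 2 := by
  rw [norm_add_sq_real, inner_smul_right, EuclideanSpace.inner_single_right, norm_smul]
  simp
  ring

/-- Directional second order condition for `u - F(|x|^2)`. -/
lemma dir_second (F F1 F2 : ℝ → ℝ) (hF : ∀ s, 0 < s → HasDerivAt F (F1 s) s)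
    (hF1 : ∀ s, 0 < s → HasDerivAt F1 (F2 s) s)
    (u : EuclideanSpace ℝ (Fin 2) → ℝ) (x : EuclideanSpace ℝ (Fin 2)) (hx : 0 < ‖x‖)
    (hu : ContDiffAt ℝ 2 u x) (hmin : IsLocalMin (fun y => u y - F (‖y‖ ^ 2)) x) (i : Fin 2) :
    0 ≤ fderiv ℝ (fun y => fderiv ℝ u y (EuclideanSpace.single i 1)) x
      (EuclideanSpace.single i 1) - (4 * x i ^ 2 * F2 (‖x‖ ^ 2) + 2 * F1 (‖x‖ ^ 2)) := by
  set e : EuclideanSpace ℝ (Fin 2) := EuclideanSpace.single i 1 with he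
  have hs : 0 < ‖x‖ ^ 2 := by positivity
  have hline : ∀ t : ℝ, HasDerivAt (fun t : ℝ => x + t • e) e t := fun t => by
    simpa using ((hasDerivAt_id t).smul_const e).const_add x
  have hq : ∀ t : ℝ, HasDerivAt (fun t : ℝ => ‖x‖ ^ 2 + 2 * t * x i + t ^ 2)
      (2 * x i + 2 * t) t := fun t => by
    have h1 := ((((hasDerivAt_id t).const_mul 2).mul_const (x i)).const_add (‖x‖ ^ 2)).add
      ((hasDerivAt_id t).pow 2)
    refine (h1.congr_deriv (by simp)).congr_of_eventuallyEq (Filter.Eventually.of_forall fun y => ?_)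
    simp
  have hlc : Filter.Tendsto (fun t : ℝ => x + t • e) (nhds 0) (nhds x) := by
    have := (hline 0).continuousAt.tendsto
    simpa using this
  have hqc : Filter.Tendsto (fun t : ℝ => ‖x‖ ^ 2 + 2 * t * x i + t ^ 2) (nhds 0)
      (nhds (‖x‖ ^ 2)) := by
    have := (hq 0).continuousAt.tendsto
    simpa using this
  have hud : ∀ᶠ y in nhds x, DifferentiableAt ℝ u y := by
    filter_upwards [hu.eventually (by simp)] with y hy
    exact hy.differentiableAt (by simp)
  refine second_deriv_nonneg (g := fun t => u (x + t • e) - F (‖x‖ ^ 2 + 2 * t * x i + t ^ 2))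
    (h := fun t => fderiv ℝ u (x + t • e) e
      - F1 (‖x‖ ^ 2 + 2 * t * x i + t ^ 2) * (2 * x i + 2 * t)) ?_ ?_ ?_
  · have := hlc.eventually hmin
    filter_upwards [this] with t ht
    simp only [he, norm_sq_line] at ht
    simpa [he] using ht
  · filter_upwards [hlc.eventually hud, hqc.eventually (lt_mem_nhds hs)] with t h1 h2
    exact (h1.hasFDerivAt.comp_hasDerivAt t (hline t)).sub ((hF _ h2).comp t (hq t))
  · have hf : DifferentiableAt ℝ (fun y => fderiv ℝ u y e) x := by
      have h1 : ContDiffAt ℝ 1 (fderiv ℝ u) x := hu.fderiv_right (by norm_num)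
      exact (h1.differentiableAt (by simp)).clm_apply (differentiableAt_const e)
    have hx0 : x = x + (0 : ℝ) • e := by simp
    have hs0 : ‖x‖ ^ 2 = ‖x‖ ^ 2 + 2 * 0 * x i + 0 ^ 2 := by simp
    have a1 : HasDerivAt (fun t : ℝ => fderiv ℝ u (x + t • e) e)
        (fderiv ℝ (fun y => fderiv ℝ u y e) x e) 0 := by
      have h2 := hf.hasFDerivAt
      have h3 : HasFDerivAt (fun y => fderiv ℝ u y e) (fderiv ℝ (fun y => fderiv ℝ u y e) x)
        (x + (0 : ℝ) • e) := by rw [← hx0]; exact h2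
      exact h3.comp_hasDerivAt 0 (hline 0)
    have a2 : HasDerivAt (fun t : ℝ => F1 (‖x‖ ^ 2 + 2 * t * x i + t ^ 2))
        (F2 (‖x‖ ^ 2) * (2 * x i + 2 * 0)) 0 := by
      have h3 : HasDerivAt F1 (F2 (‖x‖ ^ 2)) (‖x‖ ^ 2 + 2 * 0 * x i + 0 ^ 2) := by
        rw [← hs0]; exact hF1 _ hs
      exact h3.comp 0 (hq 0)
    have a3 : HasDerivAt (fun t : ℝ => 2 * x i + 2 * t) 2 0 := by
      simpa using ((hasDerivAt_id (0:ℝ)).const_mul 2).const_add (2 * x i)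
    refine (a1.sub (a2.mul a3)).congr_deriv ?_
    rw [← hs0]
    ring

/-- Radial comparison principle on a punctured ball. -/
lemma radial_comparison (R : ℝ) (F F1 F2 : ℝ → ℝ)
    (hF : ∀ s, 0 < s → HasDerivAt F (F1 s) s)
    (hF1 : ∀ s, 0 < s → HasDerivAt F1 (F2 s) s)
    (u : EuclideanSpace ℝ (Fin 2) → ℝ)
    (hu_cont : ContinuousOn u (Metric.closedBall 0 R))
    (hu_diff : ContDiffOn ℝ 2 u {x : EuclideanSpace ℝ (Fin 2) | 0 < ‖x‖ ∧ ‖x‖ < R})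
    (hineq : ∀ x : EuclideanSpace ℝ (Fin 2), 0 < ‖x‖ → ‖x‖ < R →
      lap u x < 4 * (‖x‖ ^ 2 * F2 (‖x‖ ^ 2) + F1 (‖x‖ ^ 2)))
    (hbdry : ∀ x : EuclideanSpace ℝ (Fin 2), ‖x‖ = R → F (‖x‖ ^ 2) ≤ u x)
    (ρ : ℝ) (hρ : 0 < ρ)
    (hzero : ∀ x : EuclideanSpace ℝ (Fin 2), 0 < ‖x‖ → ‖x‖ ≤ ρ → ‖x‖ ≤ R → F (‖x‖ ^ 2) ≤ u x)
    (x : EuclideanSpace ℝ (Fin 2)) (hx0 : 0 < ‖x‖) (hxR : ‖x‖ ≤ R) : F (‖x‖ ^ 2) ≤ u x := by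
  by_contra hneg
  push Not at hneg
  set r := min ρ ‖x‖ with hr
  have hrpos : 0 < r := lt_min hρ hx0
  set K : Set (EuclideanSpace ℝ (Fin 2)) := {y | r ≤ ‖y‖} ∩ Metric.closedBall 0 R with hK
  have hKc : IsCompact K :=
    (isCompact_closedBall _ _).inter_left (isClosed_le continuous_const continuous_norm)
  have hmem : ∀ y, y ∈ K ↔ r ≤ ‖y‖ ∧ ‖y‖ ≤ R := fun y => by simp [hK]
  have hxK : x ∈ K := (hmem x).2 ⟨min_le_right _ _, hxR⟩
  have hcont : ContinuousOn (fun y => u y - F (‖y‖ ^ 2)) K := by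
    refine (hu_cont.mono Set.inter_subset_right).sub fun y hy => ?_
    have hy0 : 0 < ‖y‖ := hrpos.trans_le ((hmem y).1 hy).1
    have h1 : ContinuousAt (fun y : EuclideanSpace ℝ (Fin 2) => F (‖y‖ ^ 2)) y :=
      ContinuousAt.comp (f := fun y : EuclideanSpace ℝ (Fin 2) => ‖y‖ ^ 2)
        (hF _ (by positivity)).continuousAt (by fun_prop)
    exact h1.continuousWithinAt
  obtain ⟨z, hzK, hz⟩ := hKc.exists_isMinOn ⟨x, hxK⟩ hcont
  have hzx : u z - F (‖z‖ ^ 2) < 0 := by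
    have : u z - F (‖z‖ ^ 2) ≤ u x - F (‖x‖ ^ 2) := hz hxK
    linarith
  obtain ⟨hz1, hz2⟩ := (hmem z).1 hzK
  have hz0 : 0 < ‖z‖ := hrpos.trans_le hz1
  have hzr : r < ‖z‖ := by
    refine lt_of_le_of_ne hz1 fun h => ?_
    have := hzero z hz0 (h ▸ min_le_left _ _) hz2
    linarith
  have hzR : ‖z‖ < R := by
    refine lt_of_le_of_ne hz2 fun h => ?_
    have := hbdry z h
    linarith
  have hKn : K ∈ nhds z := by
    have h1 : ∀ᶠ y in nhds z, r < ‖y‖ := continuous_norm.continuousAt.eventually (lt_mem_nhds hzr)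
    have h2 : ∀ᶠ y in nhds z, ‖y‖ < R := continuous_norm.continuousAt.eventually (gt_mem_nhds hzR)
    filter_upwards [h1, h2] with y a b
    exact (hmem y).2 ⟨a.le, b.le⟩
  have hmin : IsLocalMin (fun y => u y - F (‖y‖ ^ 2)) z := hz.isLocalMin hKn
  have hopen : IsOpen {x : EuclideanSpace ℝ (Fin 2) | 0 < ‖x‖ ∧ ‖x‖ < R} :=
    (isOpen_lt continuous_const continuous_norm).inter (isOpen_lt continuous_norm continuous_const)
  have hud : ContDiffAt ℝ 2 u z := hu_diff.contDiffAt (hopen.mem_nhds ⟨hz0, hzR⟩)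
  have d0 := dir_second F F1 F2 hF hF1 u z hz0 hud hmin 0
  have d1 := dir_second F F1 F2 hF hF1 u z hz0 hud hmin 1
  have hl := hineq z hz0 hzR
  have hn : ‖z‖ ^ 2 = z 0 ^ 2 + z 1 ^ 2 := by
    rw [EuclideanSpace.norm_sq_eq]; simp
  simp only [lap, Fin.sum_univ_two] at hl
  have : ‖z‖ ^ 2 * F2 (‖z‖ ^ 2) = z 0 ^ 2 * F2 (‖z‖ ^ 2) + z 1 ^ 2 * F2 (‖z‖ ^ 2) := by
    rw [← add_mul, ← hn]
  linarith

/-- comparison-principle estimate, key step of the paper's Lemma 4.2. -/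
theorem comparison_estimate (δ C C' α : ℝ) (hδ : 0 < δ) (hC : 0 < C) (hC' : 0 < C')
    (hα : α ∈ Set.Ioo (-1 : ℝ) 0) (lam : ℝ) (hlam : lam = C' * Real.exp (-2 * C))
    (u : EuclideanSpace ℝ (Fin 2) → ℝ)
    (hu_cont : ContinuousOn u (Metric.closedBall 0 (2 * δ)))
    (hu_diff : ContDiffOn ℝ 2 u {x : EuclideanSpace ℝ (Fin 2) | 0 < ‖x‖ ∧ ‖x‖ < 2 * δ})
    (hineq : ∀ x : EuclideanSpace ℝ (Fin 2), 0 < ‖x‖ → ‖x‖ < 2 * δ →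
      C' * (‖x‖ ^ (2 * α) * Real.exp (-2 * C) - 1) ≤ -lap u x)
    (hbdry : ∀ x : EuclideanSpace ℝ (Fin 2), ‖x‖ = 2 * δ → -C ≤ u x) :
    ∀ x : EuclideanSpace ℝ (Fin 2), ‖x‖ ≤ 2 * δ →
      -C + C' / 4 * (‖x‖ ^ 2 - (2 * δ) ^ 2) -
        lam / (4 * (1 + α) ^ 2) * (‖x‖ ^ (2 + 2 * α) - (2 * δ) ^ (2 + 2 * α)) ≤ u x := by
  obtain ⟨hα1, hα2⟩ := hα
  have hβ : 0 < 1 + α := by linarith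
  have hlampos : 0 < lam := by rw [hlam]; positivity
  set R := 2 * δ with hR
  have hRpos : 0 < R := by positivity
  have hpow : ∀ a : ℝ, 0 ≤ a → ∀ p : ℝ, (a ^ 2) ^ p = a ^ (2 * p) := fun a ha p => by
    rw [← Real.rpow_natCast a 2, ← Real.rpow_mul ha]; norm_num
  set A := lam / (4 * (1 + α) ^ 2) with hA
  have hApos : 0 < A := by positivity
  obtain ⟨m, hm⟩ : ∃ m, ∀ y ∈ Metric.closedBall (0 : EuclideanSpace ℝ (Fin 2)) R, m ≤ u y := by
    obtain ⟨m, hm⟩ := (isCompact_closedBall (0 : EuclideanSpace ℝ (Fin 2)) R).bddBelow_image hu_cont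
    exact ⟨m, fun y hy => hm ⟨y, hy, rfl⟩⟩
  -- the punctured ball with the logarithmic perturbation
  have key : ∀ ε : ℝ, 0 < ε → ∀ x : EuclideanSpace ℝ (Fin 2), 0 < ‖x‖ → ‖x‖ ≤ R →
      -C + C' / 4 * (‖x‖ ^ 2 - R ^ 2) - A * ((‖x‖ ^ 2) ^ (1 + α) - R ^ (2 + 2 * α))
        + ε * (Real.log (‖x‖ ^ 2) - Real.log (R ^ 2) + (‖x‖ ^ 2 - R ^ 2)) ≤ u x := by
    intro ε hε
    set L : ℝ := (m - A * R ^ (2 + 2 * α) + C) / ε + Real.log (R ^ 2) with hL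
    refine radial_comparison R
      (fun s => -C + C' / 4 * (s - R ^ 2) - A * (s ^ (1 + α) - R ^ (2 + 2 * α))
        + ε * (Real.log s - Real.log (R ^ 2) + (s - R ^ 2)))
      (fun s => C' / 4 - A * ((1 + α) * s ^ α) + ε * (s⁻¹ + 1))
      (fun s => - (A * ((1 + α) * (α * s ^ (α - 1)))) + ε * (-(s ^ 2)⁻¹))
      ?_ ?_ u hu_cont hu_diff ?_ ?_ (Real.exp (L / 2)) (Real.exp_pos _) ?_
    · intro s hs
      have h1 := (((hasDerivAt_id s).sub_const (R ^ 2)).const_mul (C' / 4)).const_add (-C)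
      have h2 : HasDerivAt (fun s : ℝ => s ^ (1 + α)) ((1 + α) * s ^ α) s := by
        have := Real.hasDerivAt_rpow_const (x := s) (p := 1 + α) (Or.inl hs.ne')
        simpa using this
      have h3 := (h2.sub_const (R ^ (2 + 2 * α))).const_mul A
      have h4 := ((((Real.hasDerivAt_log hs.ne').sub_const (Real.log (R ^ 2))).add
        ((hasDerivAt_id s).sub_const (R ^ 2)))).const_mul ε
      have h5 := (h1.sub h3).add h4
      exact h5.congr_deriv (by simp)
    · intro s hs
      have h2 : HasDerivAt (fun s : ℝ => s ^ α) (α * s ^ (α - 1)) s :=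
        Real.hasDerivAt_rpow_const (x := s) (p := α) (Or.inl hs.ne')
      have h5 := (((h2.const_mul (1 + α)).const_mul A).const_sub (C' / 4)).add
        (((hasDerivAt_inv hs.ne').add_const 1).const_mul ε)
      exact h5.congr_deriv (by simp)
    · intro x hx hxR
      have h := hineq x hx hxR
      have hs : 0 < ‖x‖ ^ 2 := by positivity
      rw [← hpow _ hx.le] at h
      generalize ‖x‖ ^ 2 = s at *
      have e1 : s * s ^ (α - 1) = s ^ α := by
        rw [Real.rpow_sub_one hs.ne']; field_simp
      have e2 : s * (-(A * ((1 + α) * (α * s ^ (α - 1)))) + ε * (-(s ^ 2)⁻¹))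
          = -(A * ((1 + α) * (α * s ^ α))) - ε * s⁻¹ := by
        rw [← e1]; field_simp; ring
      have e3 : 4 * (A * (1 + α) ^ 2) = lam := by rw [hA]; field_simp
      rw [e2]
      have e4 : 4 * (-(A * ((1 + α) * (α * s ^ α))) - ε * s⁻¹ +
          (C' / 4 - A * ((1 + α) * s ^ α) + ε * (s⁻¹ + 1))) =
          C' - (4 * (A * (1 + α) ^ 2)) * s ^ α + 4 * ε := by ring
      rw [e4, e3, hlam]
      linarith
    · intro x hx
      have := hbdry x hx
      rw [hx, hpow _ hRpos.le, mul_add, mul_one]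
      simpa using this
    · intro x hx hxρ hxR
      have hmx := hm x (by simpa using hxR)
      refine le_trans ?_ hmx
      have hsq : ‖x‖ ^ 2 ≤ R ^ 2 := by gcongr
      have hlog : Real.log (‖x‖ ^ 2) ≤ L := by
        rw [Real.log_pow]
        have := (Real.log_le_iff_le_exp hx).2 hxρ
        push_cast; linarith
      have t1 : C' / 4 * (‖x‖ ^ 2 - R ^ 2) ≤ 0 :=
        mul_nonpos_of_nonneg_of_nonpos (by positivity) (by linarith)
      have t2 : 0 ≤ A * (‖x‖ ^ 2) ^ (1 + α) := by positivity
      have t3 : ε * (Real.log (‖x‖ ^ 2) - Real.log (R ^ 2) + (‖x‖ ^ 2 - R ^ 2))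
          ≤ m - A * R ^ (2 + 2 * α) + C := by
        calc _ ≤ ε * (L - Real.log (R ^ 2)) := by gcongr; linarith
          _ = _ := by rw [hL]; field_simp; ring
      linarith
  have punct : ∀ x : EuclideanSpace ℝ (Fin 2), 0 < ‖x‖ → ‖x‖ ≤ R →
      -C + C' / 4 * (‖x‖ ^ 2 - R ^ 2) - A * (‖x‖ ^ (2 + 2 * α) - R ^ (2 + 2 * α)) ≤ u x := by
    intro x hx hxR
    have e : (‖x‖ ^ 2) ^ (1 + α) = ‖x‖ ^ (2 + 2 * α) := by
      rw [hpow _ hx.le, mul_add, mul_one]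
    set B := Real.log (‖x‖ ^ 2) - Real.log (R ^ 2) + (‖x‖ ^ 2 - R ^ 2) with hB
    set V := -C + C' / 4 * (‖x‖ ^ 2 - R ^ 2) - A * (‖x‖ ^ (2 + 2 * α) - R ^ (2 + 2 * α)) with hV
    have hk : ∀ ε : ℝ, 0 < ε → V + ε * B ≤ u x := fun ε hε => by
      have := key ε hε x hx hxR
      rwa [e] at this
    have ht : Filter.Tendsto (fun ε : ℝ => V + ε * B) (nhdsWithin 0 (Set.Ioi 0)) (nhds V) := by
      have : Filter.Tendsto (fun ε : ℝ => V + ε * B) (nhds 0) (nhds (V + 0 * B)) :=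
        Continuous.tendsto (by fun_prop) 0
      rw [zero_mul, add_zero] at this
      exact this.mono_left nhdsWithin_le_nhds
    exact le_of_tendsto ht (by filter_upwards [self_mem_nhdsWithin] with ε hε using hk ε hε)
  intro x hxR
  rcases (norm_nonneg x).lt_or_eq with hx | hx
  · exact punct x hx hxR
  · have hx0 : x = 0 := norm_eq_zero.1 hx.symm
    subst hx0
    have hcu : ContinuousAt u 0 :=
      hu_cont.continuousAt (Metric.closedBall_mem_nhds _ hRpos)
    have hcv : Continuous (fun x : EuclideanSpace ℝ (Fin 2) =>
        -C + C' / 4 * (‖x‖ ^ 2 - R ^ 2) - A * (‖x‖ ^ (2 + 2 * α) - R ^ (2 + 2 * α))) := by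
      have : Continuous (fun x : EuclideanSpace ℝ (Fin 2) => ‖x‖ ^ (2 + 2 * α)) :=
        continuous_norm.rpow_const fun _ => Or.inr (by linarith)
      fun_prop
    refine le_of_tendsto_of_tendsto (b := nhdsWithin 0 {0}ᶜ)
      (hcv.continuousAt.tendsto.mono_left nhdsWithin_le_nhds)
      (hcu.tendsto.mono_left nhdsWithin_le_nhds) ?_
    filter_upwards [self_mem_nhdsWithin,
      mem_nhdsWithin_of_mem_nhds (Metric.closedBall_mem_nhds (0 : EuclideanSpace ℝ (Fin 2)) hRpos)]
      with y hy1 hy2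
    exact punct y (norm_pos_iff.2 hy1) (by simpa using hy2)
end

section
/- Let δ > 0, A ∈ ℝ, C' ∈ ℝ and λ > 0. Then the integral ∫_0^{2δ} r^{1+2α} · exp( 2A + (C'/2)·(r² − (2δ)²) − (λ/(2(1+α)²))·(r^{2+2α} − (2δ)^{2+2α}) ) dr tends to +∞ as α tends to −1 from the right. -/
open Real MeasureTheory Filter

/-- the divergence computation concluding the proof of the paper's Lemma 4.2:
the integral `∫_0^{2δ} r^{1+2α} exp(2A + (C'/2)(r² − (2δ)²) − (λ/(2(1+α)²))(r^{2+2α} − (2δ)^{2+2α})) dr`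
tends to `+∞` as `α → −1⁺`. -/
theorem integral_tendsto_atTop (δ A C' lam : ℝ) (hδ : 0 < δ) (hlam : 0 < lam) :
    Tendsto (fun α : ℝ =>
        ∫ r in Set.Ioo (0 : ℝ) (2 * δ),
          r ^ (1 + 2 * α) *
            Real.exp (2 * A + C' / 2 * (r ^ 2 - (2 * δ) ^ 2) -
              lam / (2 * (1 + α) ^ 2) * (r ^ (2 + 2 * α) - (2 * δ) ^ (2 + 2 * α))))
      (nhdsWithin (-1 : ℝ) (Set.Ioi (-1 : ℝ))) atTop := by
  set D : ℝ := 2 * δ with hD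
  have hD0 : 0 < D := by positivity
  set K : ℝ := 2 * A - |C'| / 2 * D ^ 2 with hK
  have habs : ∀ r ∈ Set.Ioo (0 : ℝ) D, |C' / 2 * (r ^ 2 - D ^ 2)| ≤ |C'| / 2 * D ^ 2 := by
    intro r hr
    have h1 : r ^ 2 ≤ D ^ 2 := pow_le_pow_left₀ hr.1.le hr.2.le 2
    rw [abs_mul, abs_div, abs_two]
    apply mul_le_mul_of_nonneg_left _ (by positivity)
    rw [abs_le]
    constructor <;> nlinarith [sq_nonneg r]
  -- the explicit lower bound
  have hlow : Tendsto (fun α : ℝ => D ^ (2 + 2 * α) * Real.exp K * (2 + 2 * α)⁻¹)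
      (nhdsWithin (-1 : ℝ) (Set.Ioi (-1 : ℝ))) atTop := by
    have hlin : Tendsto (fun α : ℝ => 2 + 2 * α) (nhds (-1 : ℝ)) (nhds 0) := by
      have : Continuous (fun α : ℝ => 2 + 2 * α) := by fun_prop
      simpa using this.tendsto (-1)
    have h1 : Tendsto (fun α : ℝ => D ^ (2 + 2 * α) * Real.exp K)
        (nhdsWithin (-1 : ℝ) (Set.Ioi (-1 : ℝ))) (nhds (Real.exp K)) := by
      have h2 : Tendsto (fun α : ℝ => D ^ (2 + 2 * α)) (nhds (-1 : ℝ)) (nhds (D ^ (0 : ℝ))) :=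
        (tendsto_const_nhds (x := D)).rpow hlin (Or.inl hD0.ne')
      have h3 := h2.mul_const (Real.exp K)
      rw [Real.rpow_zero, one_mul] at h3
      exact h3.mono_left nhdsWithin_le_nhds
    refine h1.pos_mul_atTop (Real.exp_pos K) ?_
    apply Tendsto.inv_tendsto_nhdsGT_zero
    refine tendsto_nhdsWithin_iff.2 ⟨hlin.mono_left nhdsWithin_le_nhds, ?_⟩
    filter_upwards [self_mem_nhdsWithin] with α hα
    have : -1 < α := hα
    show 0 < 2 + 2 * α
    linarith
  refine tendsto_atTop_mono' _ ?_ hlow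
  filter_upwards [self_mem_nhdsWithin] with α hα
  have hα1 : -1 < α := hα
  have hexp : -1 < 1 + 2 * α := by linarith
  have hpos : 0 < 2 + 2 * α := by linarith
  have hint : IntegrableOn (fun r : ℝ => r ^ (1 + 2 * α)) (Set.Ioo 0 D) := by
    have := intervalIntegral.intervalIntegrable_rpow' (a := 0) (b := D) hexp
    rw [intervalIntegrable_iff_integrableOn_Ioo_of_le hD0.le] at this
    exact this
  have hval : ∫ r in Set.Ioo (0 : ℝ) D, r ^ (1 + 2 * α) = D ^ (2 + 2 * α) * (2 + 2 * α)⁻¹ := by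
    rw [← integral_Ioc_eq_integral_Ioo, ← intervalIntegral.integral_of_le hD0.le,
      integral_rpow (Or.inl hexp)]
    have e : 1 + 2 * α + 1 = 2 + 2 * α := by ring
    rw [e, Real.zero_rpow hpos.ne', sub_zero, div_eq_mul_inv]
  have hc : 0 ≤ lam / (2 * (1 + α) ^ 2) := by positivity
  have hint2 : IntegrableOn (fun r : ℝ => r ^ (1 + 2 * α) *
            Real.exp (2 * A + C' / 2 * (r ^ 2 - D ^ 2) -
              lam / (2 * (1 + α) ^ 2) * (r ^ (2 + 2 * α) - D ^ (2 + 2 * α)))) (Set.Ioo 0 D) := by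
    refine Integrable.mul_bdd (c := Real.exp (2 * A + |C'| / 2 * D ^ 2 +
      lam / (2 * (1 + α) ^ 2) * D ^ (2 + 2 * α))) hint ?_ ?_
    · exact Measurable.aestronglyMeasurable (by fun_prop)
    · filter_upwards [ae_restrict_mem measurableSet_Ioo] with r hr
      rw [Real.norm_eq_abs, Real.abs_exp, Real.exp_le_exp]
      have h1 := (abs_le.1 (habs r hr)).2
      have h2 := mul_nonneg hc (Real.rpow_nonneg hr.1.le (2 + 2 * α))
      linarith
  calc D ^ (2 + 2 * α) * Real.exp K * (2 + 2 * α)⁻¹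
      = ∫ r in Set.Ioo (0 : ℝ) D, r ^ (1 + 2 * α) * Real.exp K := by
        rw [integral_mul_const, hval]; ring
    _ ≤ _ := by
        refine setIntegral_mono_on (hint.mul_const _) hint2 measurableSet_Ioo ?_
        intro r hr
        apply mul_le_mul_of_nonneg_left _ (Real.rpow_nonneg hr.1.le _)
        rw [Real.exp_le_exp]
        have h1 := (abs_le.1 (habs r hr)).1
        have h2 := mul_nonneg hc (sub_nonneg.2 (Real.rpow_le_rpow hr.1.le hr.2.le hpos.le))
        linarith
end

section
/- Let ρ ∈ ℝ, δ > 0 and let Ω ⊆ ℝ² be an open set containing the closed ball {|z| ≤ δ}. Let V : ℝ² → ℝ be continuously differentiable and positive on Ω, and let v : ℝ² → ℝ be twice continuously differentiable on Ω and satisfy −Δv(z) = ρ·V(z)·e^{2v(z)} for all z ∈ Ω. Then, writing c(θ) := (δ·cos θ, δ·sin θ) and ν(θ) := (cos θ, sin θ), the following Pohozaev identity holds: δ²·∫_0^{2π} [ ρ·V(c(θ))·e^{2v(c(θ))} + 2·⟪∇v(c(θ)), ν(θ)⟫² − ‖∇v(c(θ))‖² ] dθ = ρ·∫_{{|z|<δ}}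 ( 2·V(z) + ⟪z, ∇V(z)⟫ )·e^{2v(z)} dz. -/
open Real MeasureTheory
open scoped RealInnerProductSpace

/-- The point `(δ cos θ, δ sin θ)` of `ℝ²`. -/
noncomputable def circlePt (δ θ : ℝ) : EuclideanSpace ℝ (Fin 2) :=
  (WithLp.equiv 2 (Fin 2 → ℝ)).symm ![δ * Real.cos θ, δ * Real.sin θ]

theorem aux_circlePt_norm (r θ : ℝ) : ‖circlePt r θ‖ = |r| := by
  rw [EuclideanSpace.norm_eq]
  simp only [circlePt, Fin.sum_univ_two]
  rw [← Real.sqrt_sq_eq_abs]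
  congr 1
  simp only [WithLp.equiv_symm_apply, Real.norm_eq_abs, sq_abs]
  simp
  nlinarith [Real.sin_sq_add_cos_sq θ]

theorem aux_circlePt_eq (r θ : ℝ) : circlePt r θ =
    (r * Real.cos θ) • EuclideanSpace.single (0 : Fin 2) (1 : ℝ) +
    (r * Real.sin θ) • EuclideanSpace.single (1 : Fin 2) (1 : ℝ) := by
  ext i
  fin_cases i <;> simp [circlePt]

/-- Polar coordinates on the disc. -/
theorem aux_polar (δ : ℝ) (f : EuclideanSpace ℝ (Fin 2) → ℝ) :
    ∫ z in Metric.ball (0 : EuclideanSpace ℝ (Fin 2)) δ, f z =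
      ∫ p in Set.Icc ((0 : ℝ), -π) (δ, π), p.1 * f (circlePt p.1 p.2) := by
  rw [← integral_indicator Metric.isOpen_ball.measurableSet]
  rw [← (PiLp.volume_preserving_toLp (Fin 2)).integral_comp
    (MeasurableEquiv.toLp 2 _).measurableEmbedding]
  rw [← ((volume_preserving_finTwoArrow ℝ).symm).integral_comp
    (MeasurableEquiv.measurableEmbedding _)]
  rw [← integral_comp_polarCoord_symm]
  have h1 : ∀ p ∈ polarCoord.target, p.1 • (Metric.ball (0 : EuclideanSpace ℝ (Fin 2)) δ).indicator f
      (WithLp.toLp 2 (MeasurableEquiv.finTwoArrow.symm (polarCoord.symm p))) =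
      (Set.Iio δ ×ˢ Set.univ : Set (ℝ × ℝ)).indicator
        (fun p => p.1 * f (circlePt p.1 p.2)) p := by
    intro p hp
    have hc : (WithLp.toLp 2 (MeasurableEquiv.finTwoArrow.symm (polarCoord.symm p)) :
        EuclideanSpace ℝ (Fin 2)) = circlePt p.1 p.2 := by
      ext i
      fin_cases i <;> simp [circlePt, polarCoord]
    rw [hc]
    have hp0 : 0 < p.1 := hp.1
    by_cases h : p.1 < δ
    · rw [Set.indicator_of_mem, Set.indicator_of_mem]
      · rfl
      · exact ⟨h, trivial⟩
      · simpa [aux_circlePt_norm, abs_of_pos hp0] using h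
    · rw [Set.indicator_of_notMem, Set.indicator_of_notMem]
      · simp
      · simpa using h
      · simpa [aux_circlePt_norm, abs_of_pos hp0] using h
  rw [setIntegral_congr_fun polarCoord.open_target.measurableSet h1]
  rw [setIntegral_indicator (measurableSet_Iio.prod MeasurableSet.univ)]
  have h2 : polarCoord.target ∩ Set.Iio δ ×ˢ Set.univ = Set.Ioo 0 δ ×ˢ Set.Ioo (-π) π := by
    ext p
    simp [polarCoord]
    tauto
  rw [h2, ← Set.Icc_prod_Icc]
  exact setIntegral_congr_set (Measure.set_prod_ae_eq Ioo_ae_eq_Icc Ioo_ae_eq_Icc)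

theorem aux_div (δ : ℝ) (hδ : 0 < δ) (Ω : Set (EuclideanSpace ℝ (Fin 2)))
    (hΩ : IsOpen Ω) (hball : Metric.closedBall (0 : EuclideanSpace ℝ (Fin 2)) δ ⊆ Ω)
    (P Q : EuclideanSpace ℝ (Fin 2) → ℝ) (hP : ContDiffOn ℝ 1 P Ω) (hQ : ContDiffOn ℝ 1 Q Ω) :
    ∫ z in Metric.ball (0 : EuclideanSpace ℝ (Fin 2)) δ,
      (fderiv ℝ P z (EuclideanSpace.single 0 1) + fderiv ℝ Q z (EuclideanSpace.single 1 1)) =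
    ∫ θ in (0 : ℝ)..(2 * π),
      δ * (P (circlePt δ θ) * Real.cos θ + Q (circlePt δ θ) * Real.sin θ) := by
  set C : ℝ × ℝ → EuclideanSpace ℝ (Fin 2) := fun p => circlePt p.1 p.2 with hC
  let dC : ℝ × ℝ → ℝ × ℝ →L[ℝ] EuclideanSpace ℝ (Fin 2) := fun p =>
    (p.1 • (-Real.sin p.2) • ContinuousLinearMap.snd ℝ ℝ ℝ
      + Real.cos p.2 • ContinuousLinearMap.fst ℝ ℝ ℝ).smulRight (EuclideanSpace.single 0 1) +
    (p.1 • (Real.cos p.2) • ContinuousLinearMap.snd ℝ ℝ ℝ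
      + Real.sin p.2 • ContinuousLinearMap.fst ℝ ℝ ℝ).smulRight (EuclideanSpace.single 1 1)
  have hcos : ∀ p : ℝ × ℝ, HasFDerivAt (fun p : ℝ × ℝ => Real.cos p.2)
      ((-Real.sin p.2) • ContinuousLinearMap.snd ℝ ℝ ℝ) p := fun p =>
    (Real.hasDerivAt_cos p.2).comp_hasFDerivAt p hasFDerivAt_snd
  have hsin : ∀ p : ℝ × ℝ, HasFDerivAt (fun p : ℝ × ℝ => Real.sin p.2)
      ((Real.cos p.2) • ContinuousLinearMap.snd ℝ ℝ ℝ) p := fun p =>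
    (Real.hasDerivAt_sin p.2).comp_hasFDerivAt p hasFDerivAt_snd
  have hfst : ∀ p : ℝ × ℝ, HasFDerivAt (fun p : ℝ × ℝ => p.1)
      (ContinuousLinearMap.fst ℝ ℝ ℝ) p := fun p => hasFDerivAt_fst
  have hCd : ∀ p, HasFDerivAt C (dC p) p := by
    intro p
    have e : C = fun p => (p.1 * Real.cos p.2) • EuclideanSpace.single (0 : Fin 2) (1 : ℝ) +
        (p.1 * Real.sin p.2) • EuclideanSpace.single (1 : Fin 2) (1 : ℝ) := by
      funext p; exact aux_circlePt_eq _ _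
    rw [e]
    exact (((hfst p).mul (hcos p)).smul_const _).add (((hfst p).mul (hsin p)).smul_const _)
  have hCc : Continuous C := continuous_iff_continuousAt.2 fun p => (hCd p).continuousAt
  have hCmem : ∀ p ∈ Set.Icc ((0 : ℝ), -π) (δ, π), C p ∈ Ω := by
    intro p hp
    apply hball
    rw [← Set.Icc_prod_Icc] at hp
    simp only [hC, mem_closedBall_zero_iff, aux_circlePt_norm]
    rw [abs_of_nonneg hp.1.1]
    exact hp.1.2
  have hPd : ∀ z ∈ Ω, HasFDerivAt P (fderiv ℝ P z) z := fun z hz =>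
    ((hP.differentiableOn (by norm_num)).differentiableAt (hΩ.mem_nhds hz)).hasFDerivAt
  have hQd : ∀ z ∈ Ω, HasFDerivAt Q (fderiv ℝ Q z) z := fun z hz =>
    ((hQ.differentiableOn (by norm_num)).differentiableAt (hΩ.mem_nhds hz)).hasFDerivAt
  have hPc : ContinuousOn (fun p => P (C p)) (Set.Icc ((0 : ℝ), -π) (δ, π)) :=
    hP.continuousOn.comp hCc.continuousOn hCmem
  have hQc : ContinuousOn (fun p => Q (C p)) (Set.Icc ((0 : ℝ), -π) (δ, π)) :=
    hQ.continuousOn.comp hCc.continuousOn hCmem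
  let A : ℝ × ℝ → ℝ × ℝ →L[ℝ] ℝ := fun p => (fderiv ℝ P (C p)).comp (dC p)
  let B : ℝ × ℝ → ℝ × ℝ →L[ℝ] ℝ := fun p => (fderiv ℝ Q (C p)).comp (dC p)
  have hA : ∀ p ∈ Set.Icc ((0 : ℝ), -π) (δ, π), HasFDerivAt (fun p => P (C p)) (A p) p :=
    fun p hp => (hPd _ (hCmem p hp)).comp p (hCd p)
  have hB : ∀ p ∈ Set.Icc ((0 : ℝ), -π) (δ, π), HasFDerivAt (fun p => Q (C p)) (B p) p :=
    fun p hp => (hQd _ (hCmem p hp)).comp p (hCd p)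
  have hsub : ∀ p ∈ Set.Ioo (0 : ℝ) δ ×ˢ Set.Ioo (-π) π, p ∈ Set.Icc ((0 : ℝ), -π) (δ, π) := by
    intro p hp
    rw [← Set.Icc_prod_Icc]
    exact ⟨Set.Ioo_subset_Icc_self hp.1, Set.Ioo_subset_Icc_self hp.2⟩
  let dF : ℝ × ℝ → ℝ × ℝ →L[ℝ] ℝ := fun p =>
    p.1 • ((P (C p) • ((-Real.sin p.2) • ContinuousLinearMap.snd ℝ ℝ ℝ) + Real.cos p.2 • A p) +
      (Q (C p) • (Real.cos p.2 • ContinuousLinearMap.snd ℝ ℝ ℝ) + Real.sin p.2 • B p)) +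
    (P (C p) * Real.cos p.2 + Q (C p) * Real.sin p.2) • ContinuousLinearMap.fst ℝ ℝ ℝ
  let dG : ℝ × ℝ → ℝ × ℝ →L[ℝ] ℝ := fun p =>
    (Q (C p) • ((-Real.sin p.2) • ContinuousLinearMap.snd ℝ ℝ ℝ) + Real.cos p.2 • B p) -
      (P (C p) • (Real.cos p.2 • ContinuousLinearMap.snd ℝ ℝ ℝ) + Real.sin p.2 • A p)
  have hdiv : ∀ p, dF p (1, 0) + dG p (0, 1) = p.1 * (fderiv ℝ P (C p) (EuclideanSpace.single 0 1)
      + fderiv ℝ Q (C p) (EuclideanSpace.single 1 1)) := by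
    intro p
    simp [dF, dG, A, B, dC]
    linear_combination (p.1 * (fderiv ℝ P (C p) (EuclideanSpace.single 0 1)
      + fderiv ℝ Q (C p) (EuclideanSpace.single 1 1))) * Real.sin_sq_add_cos_sq p.2
  have key := integral_divergence_prod_Icc_of_hasFDerivAt_of_le
    (fun p => p.1 * (P (C p) * Real.cos p.2 + Q (C p) * Real.sin p.2))
    (fun p => Q (C p) * Real.cos p.2 - P (C p) * Real.sin p.2) dF dG ((0 : ℝ), -π) (δ, π)
    ⟨hδ.le, by simp only []; linarith [Real.pi_pos]⟩
    (continuousOn_fst.mul ((hPc.mul (Real.continuous_cos.comp continuous_snd).continuousOn).add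
      (hQc.mul (Real.continuous_sin.comp continuous_snd).continuousOn)))
    ((hQc.mul (Real.continuous_cos.comp continuous_snd).continuousOn).sub
      (hPc.mul (Real.continuous_sin.comp continuous_snd).continuousOn))
    (fun p hp => (hfst p).mul (((hA p (hsub p hp)).mul (hcos p)).add
      ((hB p (hsub p hp)).mul (hsin p))))
    (fun p hp => ((hB p (hsub p hp)).mul (hcos p)).sub
      ((hA p (hsub p hp)).mul (hsin p)))
    (by
      apply ContinuousOn.integrableOn_compact isCompact_Icc
      simp only [hdiv]
      have h1 := (hP.continuousOn_fderiv_of_isOpen hΩ le_rfl).comp hCc.continuousOn hCmem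
      have h2 := (hQ.continuousOn_fderiv_of_isOpen hΩ le_rfl).comp hCc.continuousOn hCmem
      exact continuousOn_fst.mul ((h1.clm_apply continuousOn_const).add
        (h2.clm_apply continuousOn_const)))
  simp only [hdiv] at key
  rw [aux_polar]
  refine Eq.trans key ?_
  have hper : ∀ x, C (x, π) = C (x, -π) := by
    intro x; simp [hC, circlePt]
  have hper2 : Function.Periodic (fun θ =>
      δ * (P (circlePt δ θ) * Real.cos θ + Q (circlePt δ θ) * Real.sin θ)) (2 * π) := by
    intro θ; simp [circlePt]
  have := hper2.intervalIntegral_add_eq (-π) 0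
  rw [show -π + 2 * π = π by ring, zero_add] at this
  rw [← this]
  simp only [hper]
  simp [hC]

/-- paper's Lemma 4.9, the Pohozaev identity in isothermal coordinates. -/
theorem pohozaev_identity (ρ δ : ℝ) (hδ : 0 < δ) (Ω : Set (EuclideanSpace ℝ (Fin 2)))
    (hΩ : IsOpen Ω) (hball : Metric.closedBall (0 : EuclideanSpace ℝ (Fin 2)) δ ⊆ Ω)
    (V : EuclideanSpace ℝ (Fin 2) → ℝ) (hV : ContDiffOn ℝ 1 V Ω)
    (hVpos : ∀ z ∈ Ω, 0 < V z)
    (v : EuclideanSpace ℝ (Fin 2) → ℝ) (hv : ContDiffOn ℝ 2 v Ω)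
    (heq : ∀ z ∈ Ω, -lap v z = ρ * V z * Real.exp (2 * v z)) :
    δ ^ 2 * ∫ θ in (0 : ℝ)..(2 * Real.pi),
        (ρ * V (circlePt δ θ) * Real.exp (2 * v (circlePt δ θ)) +
          2 * ⟪gradient v (circlePt δ θ), circlePt 1 θ⟫ ^ 2 -
          ‖gradient v (circlePt δ θ)‖ ^ 2) =
      ρ * ∫ z in Metric.ball (0 : EuclideanSpace ℝ (Fin 2)) δ,
        (2 * V z + ⟪z, gradient V z⟫) * Real.exp (2 * v z) := by
  let e : Fin 2 → EuclideanSpace ℝ (Fin 2) := fun i => EuclideanSpace.single i 1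
  let w : Fin 2 → EuclideanSpace ℝ (Fin 2) → ℝ := fun i z => fderiv ℝ v z (e i)
  have hgrad : ∀ (f : EuclideanSpace ℝ (Fin 2) → ℝ) z i, gradient f z i = fderiv ℝ f z (e i) := by
    intro f z i
    have h1 : ⟪gradient f z, e i⟫ = fderiv ℝ f z (e i) := by
      simp [gradient]
    rw [← h1, EuclideanSpace.inner_single_right]
    simp
  have hw : ∀ i, ContDiffOn ℝ 1 (w i) Ω := fun i =>
    (hv.fderiv_of_isOpen hΩ (by norm_num)).clm_apply contDiffOn_const
  have hv1 : ContDiffOn ℝ 1 v Ω := hv.of_le (by norm_num)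
  have hx : ∀ i : Fin 2, ContDiffOn ℝ 1 (fun z : EuclideanSpace ℝ (Fin 2) => z i) Ω := fun i =>
    (EuclideanSpace.proj (𝕜 := ℝ) (ι := Fin 2) i).contDiff.contDiffOn
  let S : EuclideanSpace ℝ (Fin 2) → ℝ := fun z => 2 * (z 0 * w 0 z + z 1 * w 1 z)
  let T : EuclideanSpace ℝ (Fin 2) → ℝ := fun z =>
    ρ * V z * Real.exp (2 * v z) - (w 0 z * w 0 z + w 1 z * w 1 z)
  have hS : ContDiffOn ℝ 1 S Ω :=
    contDiffOn_const.mul (((hx 0).mul (hw 0)).add ((hx 1).mul (hw 1)))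
  have hT : ContDiffOn ℝ 1 T Ω :=
    ((contDiffOn_const.mul hV).mul (contDiffOn_const.mul hv1).exp).sub
      (((hw 0).mul (hw 0)).add ((hw 1).mul (hw 1)))
  have hXi : ∀ i : Fin 2, ContDiffOn ℝ 1 (fun z => S z * w i z + T z * z i) Ω := fun i =>
    (hS.mul (hw i)).add (hT.mul (hx i))
  have key := aux_div δ hδ Ω hΩ hball _ _ (hXi 0) (hXi 1)
  rw [← intervalIntegral.integral_const_mul, ← integral_const_mul]
  have hd : ∀ f : EuclideanSpace ℝ (Fin 2) → ℝ, ContDiffOn ℝ 1 f Ω → ∀ z ∈ Ω,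
      HasFDerivAt f (fderiv ℝ f z) z := fun f hf z hz =>
    ((hf.differentiableOn (by norm_num)).differentiableAt (hΩ.mem_nhds hz)).hasFDerivAt
  have hL : ∀ θ, δ ^ 2 * (ρ * V (circlePt δ θ) * Real.exp (2 * v (circlePt δ θ)) +
          2 * ⟪gradient v (circlePt δ θ), circlePt 1 θ⟫ ^ 2 -
          ‖gradient v (circlePt δ θ)‖ ^ 2) =
      δ * ((S (circlePt δ θ) * w 0 (circlePt δ θ) + T (circlePt δ θ) * circlePt δ θ 0) * Real.cos θ
        + (S (circlePt δ θ) * w 1 (circlePt δ θ) + T (circlePt δ θ) * circlePt δ θ 1)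
          * Real.sin θ) := by
    intro θ
    have c0 : ∀ r, circlePt r θ 0 = r * Real.cos θ := by intro r; simp [circlePt]
    have c1 : ∀ r, circlePt r θ 1 = r * Real.sin θ := by intro r; simp [circlePt]
    rw [EuclideanSpace.norm_sq_eq, PiLp.inner_apply]
    simp only [Fin.sum_univ_two, hgrad, S, T, c0, c1, Real.norm_eq_abs, sq_abs]
    simp only [w, RCLike.inner_apply, conj_trivial, c0, c1]
    linear_combination (-δ ^ 2 * (ρ * V (circlePt δ θ) * Real.exp (2 * v (circlePt δ θ)) -
      ((fderiv ℝ v (circlePt δ θ) (e 0)) ^ 2 + (fderiv ℝ v (circlePt δ θ) (e 1)) ^ 2)))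
        * Real.sin_sq_add_cos_sq θ
  simp only [hL]
  rw [← key]
  apply setIntegral_congr_fun Metric.isOpen_ball.measurableSet
  intro z hz
  symm
  have hzΩ : z ∈ Ω := hball (Metric.ball_subset_closedBall hz)
  have hxd : ∀ i : Fin 2, HasFDerivAt (fun z : EuclideanSpace ℝ (Fin 2) => z i)
    (EuclideanSpace.proj (𝕜 := ℝ) (ι := Fin 2) i) z := fun i =>
    (EuclideanSpace.proj (𝕜 := ℝ) (ι := Fin 2) i).hasFDerivAt
  have hwd : ∀ i, HasFDerivAt (w i) (fderiv ℝ (w i) z) z := fun i => hd _ (hw i) z hzΩ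
  have hVd := hd V hV z hzΩ
  have hvd := hd v hv1 z hzΩ
  have hSd := (((hxd 0).mul (hwd 0)).add ((hxd 1).mul (hwd 1))).const_mul 2
  have hTd := ((hVd.const_mul ρ).mul (hvd.const_mul 2).exp).sub
    (((hwd 0).mul (hwd 0)).add ((hwd 1).mul (hwd 1)))
  have hXd : ∀ i : Fin 2, _ := fun i => ((hSd.mul (hwd i)).add (hTd.mul (hxd i))).fderiv
  have h2d : DifferentiableAt ℝ (fderiv ℝ v) z :=
    ((hv.fderiv_of_isOpen hΩ (m := 1) (by norm_num)).differentiableOn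
      (by norm_num)).differentiableAt (hΩ.mem_nhds hzΩ)
  have hw2 : ∀ i u, fderiv ℝ (w i) z u = fderiv ℝ (fderiv ℝ v) z u (e i) := by
    intro i u
    have := (h2d.hasFDerivAt.clm_apply (hasFDerivAt_const (e i) z)).fderiv
    change fderiv ℝ (fun y => fderiv ℝ v y (e i)) z u = _
    rw [this]; simp
  have hsym : fderiv ℝ (w 0) z (e 1) = fderiv ℝ (w 1) z (e 0) := by
    rw [hw2, hw2]
    exact (hv.contDiffAt (hΩ.mem_nhds hzΩ)).isSymmSndFDerivAt (by simp) _ _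
  have hE := heq z hzΩ
  have hlap : lap v z = fderiv ℝ (w 0) z (e 0) + fderiv ℝ (w 1) z (e 1) := by
    simp [lap, Fin.sum_univ_two, w, e]
  rw [hlap] at hE
  have e00 : e 0 0 = 1 := by simp [e]
  have e01 : e 0 1 = 0 := by simp [e]
  have e10 : e 1 0 = 0 := by simp [e]
  have e11 : e 1 1 = 1 := by simp [e]
  have hX0 := congrArg (fun L => L (e 0)) (hXd 0)
  have hX1 := congrArg (fun L => L (e 1)) (hXd 1)
  have hin : ⟪z, gradient V z⟫ = z 0 * fderiv ℝ V z (e 0) + z 1 * fderiv ℝ V z (e 1) := by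
    rw [PiLp.inner_apply]
    simp only [Fin.sum_univ_two, hgrad, RCLike.inner_apply, conj_trivial]
    ring
  simp only [ContinuousLinearMap.add_apply, ContinuousLinearMap.sub_apply,
    ContinuousLinearMap.smul_apply, smul_eq_mul, PiLp.proj_apply, e00, e01, e10, e11] at hX0 hX1
  change _ = fderiv ℝ (fun z => S z * w 0 z + T z * z 0) z (e 0) +
    fderiv ℝ (fun z => S z * w 1 z + T z * z 1) z (e 1)
  refine Eq.trans ?_ (congrArg₂ (· + ·) hX0 hX1).symm
  simp only [hin]
  have hw0 : ∀ i, fderiv ℝ v z (e i) = w i z := fun i => rfl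
  simp only [hw0, Pi.sub_apply, Pi.add_apply, Pi.mul_apply]
  linear_combination (2 * (z 0 * w 0 z + z 1 * w 1 z)) * hE
    - 2 * (z 0 * w 1 z - z 1 * w 0 z) * hsym
end
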